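/- arXiv:2206.07354 — 6 statements merged into one kernel-verified Lean document; each statement's English description precedes it below -/
import Mathlib

section
/- For every ε > 0 there exists n₀ ∈ ℕ such that every reduced hypergraph 𝒜 whose index set has size at least n₀ which admits a bicolouring φ with τ₂(𝒜, φ) ≥ 1/3 + ε supports a K₅⁽³⁾. -/
open Finset Classical

noncomputable section

/-- A reduced hypergraph: a finite (linearly ordered, here `ℕ`) index set `I`,
pairwise disjoint nonempty finite vertex classes `P i j` for distinct `i j ∈ I`,
and for each triple of distinct indices a tripartite 3-uniform constituent,
encoded by a symmetric edge predicate on vertices. -/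
structure ReducedHG where
  I : Finset ℕ
  P : ℕ → ℕ → Finset ℕ
  Psymm : ∀ i j, P i j = P j i
  Pnonempty : ∀ i j, i ∈ I → j ∈ I → i ≠ j → (P i j).Nonempty
  Pdisjoint : ∀ i j k l, i ≠ j → k ≠ l → ({i, j} : Finset ℕ) ≠ ({k, l} : Finset ℕ) →
      Disjoint (P i j) (P k l)
  Edge : ℕ → ℕ → ℕ → Prop
  EdgeSymm : ∀ a b c, Edge a b c → Edge b a c
  EdgeSymm' : ∀ a b c, Edge a b c → Edge a c b
  EdgeValid : ∀ a b c, Edge a b c → ∃ i j k, i ∈ I ∧ j ∈ I ∧ k ∈ I ∧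
      i ≠ j ∧ i ≠ k ∧ j ≠ k ∧ a ∈ P i j ∧ b ∈ P i k ∧ c ∈ P j k

namespace ReducedHG

variable (A : ReducedHG)

/-- The neighbourhood, inside the vertex class `P j k`, of two vertices `a`, `b`. -/
def nbhd (j k : ℕ) (a b : ℕ) : Finset ℕ := (A.P j k).filter fun c => A.Edge a b c

/-- The number of crossing edges between three vertex sets. -/
def ecount (X Y Z : Finset ℕ) : ℕ :=
  ((X ×ˢ Y ×ˢ Z).filter fun t => A.Edge t.1 t.2.1 t.2.2).card

/-- `(d, ee)`-density: every pair of vertices sharing an index has large degree. -/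
def EEDense (d : ℝ) : Prop :=
  ∀ i j k, i ∈ A.I → j ∈ A.I → k ∈ A.I → i ≠ j → i ≠ k → j ≠ k →
    ∀ a ∈ A.P i j, ∀ b ∈ A.P i k,
      d * ((A.P j k).card : ℝ) ≤ ((A.nbhd j k a b).card : ℝ)

/-- `(μ, vvv)`-density: every constituent has many edges. -/
def VVVDense (μ : ℝ) : Prop :=
  ∀ i j k, i ∈ A.I → j ∈ A.I → k ∈ A.I → i ≠ j → i ≠ k → j ≠ k →
    μ * (((A.P i j).card : ℝ) * ((A.P i k).card : ℝ) * ((A.P j k).card : ℝ)) ≤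
      (A.ecount (A.P i j) (A.P i k) (A.P j k) : ℝ)

/-- The reduced hypergraph supports a `K₅⁽³⁾`. -/
def SupportsK5 : Prop :=
  ∃ J ⊆ A.I, J.card = 5 ∧ ∃ f : ℕ → ℕ → ℕ,
    (∀ i ∈ J, ∀ j ∈ J, f i j = f j i) ∧
    (∀ i ∈ J, ∀ j ∈ J, i ≠ j → f i j ∈ A.P i j) ∧
    (∀ i ∈ J, ∀ j ∈ J, ∀ k ∈ J, i ≠ j → i ≠ k → j ≠ k →
      A.Edge (f i j) (f i k) (f j k))

/-- `ε`-wicked: `(1/3 + ε, ee)`-dense and not supporting a `K₅⁽³⁾`. -/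
def Wicked (ε : ℝ) : Prop := A.EEDense (1/3 + ε) ∧ ¬ A.SupportsK5

/-- A `J`-transversal: one vertex in each class `P i j`, `ij ∈ J⁽²⁾`. -/
def IsTransversal (J : Finset ℕ) (Q : ℕ → ℕ → ℕ) : Prop :=
  (∀ i ∈ J, ∀ j ∈ J, Q i j = Q j i) ∧ ∀ i ∈ J, ∀ j ∈ J, i ≠ j → Q i j ∈ A.P i j

/-- A `(K, L)`-transversal: one vertex in each class `P k l`, `(k, l) ∈ K × L`. -/
def IsTransversal2 (K L : Finset ℕ) (Q : ℕ → ℕ → ℕ) : Prop :=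
  ∀ k ∈ K, ∀ l ∈ L, Q k l ∈ A.P k l

/-- An inhabited triple of `J`-transversals. -/
def InhabitedTriple (J : Finset ℕ) (Q R S : ℕ → ℕ → ℕ) : Prop :=
  ∀ i ∈ J, ∀ j ∈ J, ∀ k ∈ J, i < j → j < k → A.Edge (Q i j) (R i k) (S j k)

/-- An inhabited triple consisting of a `(K,L)`-, a `(K,M)`- and an `(L,M)`-transversal. -/
def InhabitedTriple2 (K L M : Finset ℕ) (Q R S : ℕ → ℕ → ℕ) : Prop :=
  ∀ k ∈ K, ∀ l ∈ L, ∀ m ∈ M, A.Edge (Q k l) (R k m) (S l m)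

/-- `Φ` is a `μ`-hole on `J`. -/
def IsHole (μ : ℝ) (J : Finset ℕ) (Φ : Finset ℕ) : Prop :=
  (∀ i ∈ J, ∀ j ∈ J, i ≠ j → (Φ ∩ A.P i j).Nonempty) ∧
  ∀ i ∈ J, ∀ j ∈ J, ∀ k ∈ J, i ≠ j → i ≠ k → j ≠ k →
    (A.ecount (Φ ∩ A.P i j) (Φ ∩ A.P i k) (Φ ∩ A.P j k) : ℝ) ≤
      μ * (((A.P i j).card : ℝ) * ((A.P i k).card : ℝ) * ((A.P j k).card : ℝ))

/-- `Φ` is a `(μ, ϑ)`-hole on `J` (a `μ`-hole of width at least `ϑ`). -/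
def IsHoleW (μ ϑ : ℝ) (J : Finset ℕ) (Φ : Finset ℕ) : Prop :=
  A.IsHole μ J Φ ∧ ∀ i ∈ J, ∀ j ∈ J, i ≠ j →
    ϑ * ((A.P i j).card : ℝ) ≤ (((Φ ∩ A.P i j)).card : ℝ)

/-- Two holes are `ε`-intersecting on `J`. -/
def HolesIntersecting (ε : ℝ) (J : Finset ℕ) (Φ Ψ : Finset ℕ) : Prop :=
  ∀ i ∈ J, ∀ j ∈ J, i ≠ j →
    ε * ((A.P i j).card : ℝ) ≤ ((Φ ∩ Ψ ∩ A.P i j).card : ℝ)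

/-- Two holes are `ε`-disjoint on `J`. -/
def HolesDisjoint (ε : ℝ) (J : Finset ℕ) (Φ Ψ : Finset ℕ) : Prop :=
  ∀ i ∈ J, ∀ j ∈ J, i ≠ j →
    ((Φ ∩ Ψ ∩ A.P i j).card : ℝ) < ε * ((A.P i j).card : ℝ)

/-- The link on `K` of the family `k ↦ f k`, where `f k` is a vertex in a class `P k ·`:
`⋃_{k ≠ k' ∈ K} N(f k, f k')`. -/
def link (K : Finset ℕ) (f : ℕ → ℕ) : Finset ℕ :=
  ((K ×ˢ K).filter fun p => p.1 ≠ p.2).biUnion fun p => A.nbhd p.1 p.2 (f p.1) (f p.2)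

/-- The pair consisting of a transversal `T` on `Sh × B` and a transversal `U` on `Sh × C`
has `δ`-intersecting links. -/
def IntersectingLinks (δ : ℝ) (Sh B C : Finset ℕ) (T U : ℕ → ℕ → ℕ) : Prop :=
  ∀ a ∈ Sh, ∀ a' ∈ Sh, a ≠ a' → ∀ b ∈ B, ∀ c ∈ C,
    δ * ((A.P a a').card : ℝ) ≤
      (((A.nbhd a a' (T a b) (T a' b)) ∩ (A.nbhd a a' (U a c) (U a' c))).card : ℝ)

/-- The pair consisting of a transversal `T` on `Sh × B` and a transversal `U` on `Sh × C`
has `δ`-disjoint links. -/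
def DisjointLinks (δ : ℝ) (Sh B C : Finset ℕ) (T U : ℕ → ℕ → ℕ) : Prop :=
  ∀ a ∈ Sh, ∀ a' ∈ Sh, a ≠ a' → ∀ b ∈ B, ∀ c ∈ C,
    (((A.nbhd a a' (T a b) (T a' b)) ∩ (A.nbhd a a' (U a c) (U a' c))).card : ℝ) <
      δ * ((A.P a a').card : ℝ)

/-- A bicolouring of the reduced hypergraph: both colours appear in every vertex class and
no edge is monochromatic. -/
def IsBicolouring (φ : ℕ → Bool) : Prop :=
  (∀ i ∈ A.I, ∀ j ∈ A.I, i ≠ j →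
    (∃ v ∈ A.P i j, φ v = true) ∧ (∃ v ∈ A.P i j, φ v = false)) ∧
  ∀ a b c, A.Edge a b c → ¬ (φ a = φ b ∧ φ b = φ c)

/-- The minimum monochromatic codegree density is at least `x`: `τ₂(A, φ) ≥ x`. -/
def Tau2Ge (φ : ℕ → Bool) (x : ℝ) : Prop :=
  ∀ i j k, i ∈ A.I → j ∈ A.I → k ∈ A.I → i ≠ j → i ≠ k → j ≠ k →
    ∀ a ∈ A.P i j, ∀ b ∈ A.P i k, φ a = φ b →
      x * ((A.P j k).card : ℝ) ≤ ((A.nbhd j k a b).card : ℝ)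

/-- The `γ`-bad left cherries (both vertices in one hole, many neighbours outside
the other hole). -/
def badLeft (Φ Ψ : Finset ℕ) (γ : ℝ) (i j k : ℕ) : Finset (ℕ × ℕ) :=
  (A.P i j ×ˢ A.P i k).filter fun p =>
    (p.1 ∈ Φ ∧ p.2 ∈ Φ ∧ γ * ((A.P j k).card : ℝ) ≤ (((A.nbhd j k p.1 p.2) \ Ψ).card : ℝ)) ∨
    (p.1 ∈ Ψ ∧ p.2 ∈ Ψ ∧ γ * ((A.P j k).card : ℝ) ≤ (((A.nbhd j k p.1 p.2) \ Φ).card : ℝ))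

/-- The `γ`-bad middle cherries. -/
def badMid (Φ Ψ : Finset ℕ) (γ : ℝ) (i j k : ℕ) : Finset (ℕ × ℕ) :=
  (A.P i j ×ˢ A.P j k).filter fun p =>
    (p.1 ∈ Φ ∧ p.2 ∈ Φ ∧ γ * ((A.P i k).card : ℝ) ≤ (((A.nbhd i k p.1 p.2) \ Ψ).card : ℝ)) ∨
    (p.1 ∈ Ψ ∧ p.2 ∈ Ψ ∧ γ * ((A.P i k).card : ℝ) ≤ (((A.nbhd i k p.1 p.2) \ Φ).card : ℝ))

/-- The `γ`-bad right cherries. -/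
def badRight (Φ Ψ : Finset ℕ) (γ : ℝ) (i j k : ℕ) : Finset (ℕ × ℕ) :=
  (A.P i k ×ˢ A.P j k).filter fun p =>
    (p.1 ∈ Φ ∧ p.2 ∈ Φ ∧ γ * ((A.P i j).card : ℝ) ≤ (((A.nbhd i j p.1 p.2) \ Ψ).card : ℝ)) ∨
    (p.1 ∈ Ψ ∧ p.2 ∈ Ψ ∧ γ * ((A.P i j).card : ℝ) ≤ (((A.nbhd i j p.1 p.2) \ Φ).card : ℝ))

end ReducedHG

section helpers

lemma aux_inter2 (U : Finset ℕ) (p q : ℕ → Prop) (a b : ℝ)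
    (hp : a * (U.card : ℝ) ≤ ((U.filter p).card : ℝ))
    (hq : b * (U.card : ℝ) < ((U.filter q).card : ℝ)) (hab : 1 ≤ a + b) :
    ∃ x ∈ U, p x ∧ q x := by
  by_contra hcon
  push Not at hcon
  have hd : Disjoint (U.filter p) (U.filter q) := by
    rw [Finset.disjoint_filter]; exact hcon
  have h1 : (U.filter p).card + (U.filter q).card ≤ U.card := by
    rw [← Finset.card_union_of_disjoint hd]
    exact Finset.card_le_card (Finset.union_subset (Finset.filter_subset _ _) (Finset.filter_subset _ _))
  have h2 : ((U.filter p).card : ℝ) + ((U.filter q).card : ℝ) ≤ (U.card : ℝ) := by exact_mod_cast h1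
  have h3 : (0 : ℝ) ≤ (U.card : ℝ) := by positivity
  nlinarith

lemma aux_inter3 (U : Finset ℕ) (p q r : ℕ → Prop)
    (h : 2 * (U.card : ℝ) < ((U.filter p).card : ℝ) + ((U.filter q).card : ℝ)
      + ((U.filter r).card : ℝ)) :
    ∃ x ∈ U, p x ∧ q x ∧ r x := by
  by_contra hcon
  push Not at hcon
  have h1 : (U.filter p).card + (U.filter q).card + (U.filter r).card ≤ 2 * U.card := by
    rw [Finset.card_filter, Finset.card_filter, Finset.card_filter, ← Finset.sum_add_distrib,
      ← Finset.sum_add_distrib, mul_comm, ← smul_eq_mul]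
    apply Finset.sum_le_card_nsmul
    intro x hx
    have := hcon x hx
    split_ifs <;> simp_all
  have : (((U.filter p).card + (U.filter q).card + (U.filter r).card : ℕ) : ℝ)
      ≤ ((2 * U.card : ℕ) : ℝ) := by exact_mod_cast h1
  push_cast at this
  linarith

lemma aux_dc (X Y : Finset ℕ) (e : ℕ → ℕ → Prop) (b : ℝ)
    (h : ∀ y ∈ Y, b * (X.card : ℝ) ≤ ((X.filter fun x => e x y).card : ℝ)) :
    (X.card : ℝ) * (b * (Y.card : ℝ)) ≤ ∑ x ∈ X, ((Y.filter fun y => e x y).card : ℝ) := by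
  have h1 : ∑ x ∈ X, ((Y.filter fun y => e x y).card : ℝ)
      = ∑ y ∈ Y, ((X.filter fun x => e x y).card : ℝ) := by
    have := Finset.sum_card_bipartiteAbove_eq_sum_card_bipartiteBelow (s := X) (t := Y) e
    unfold Finset.bipartiteAbove Finset.bipartiteBelow at this
    exact_mod_cast this
  rw [h1]
  calc (X.card : ℝ) * (b * (Y.card : ℝ)) = ∑ y ∈ Y, b * (X.card : ℝ) := by
        rw [Finset.sum_const, nsmul_eq_mul]; ring
    _ ≤ _ := Finset.sum_le_sum h

lemma aux_exists (X Y : Finset ℕ) (hX : X.Nonempty) (e : ℕ → ℕ → Prop) (b : ℝ)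
    (h : ∀ y ∈ Y, b * (X.card : ℝ) ≤ ((X.filter fun x => e x y).card : ℝ)) :
    ∃ x ∈ X, b * (Y.card : ℝ) ≤ ((Y.filter fun y => e x y).card : ℝ) := by
  apply Finset.exists_le_of_sum_le hX
  have := aux_dc X Y e b h
  rwa [Finset.sum_const, nsmul_eq_mul]

lemma aux_good (X Y : Finset ℕ) (hY : Y.Nonempty) (e : ℕ → ℕ → Prop) (a b : ℝ) (ha : 0 < a)
    (h : ∀ y ∈ Y, b * (X.card : ℝ) ≤ ((X.filter fun x => e x y).card : ℝ)) :
    ((a + b - 1) / a) * (X.card : ℝ) ≤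
      ((X.filter fun x => (1 - a) * (Y.card : ℝ) < ((Y.filter fun y => e x y).card : ℝ)).card : ℝ) := by
  have h0 := aux_dc X Y e b h
  set G := X.filter fun x => (1 - a) * (Y.card : ℝ) < ((Y.filter fun y => e x y).card : ℝ) with hG
  have hy : (0 : ℝ) < (Y.card : ℝ) := by exact_mod_cast hY.card_pos
  have h1 : ∑ x ∈ X, ((Y.filter fun y => e x y).card : ℝ) ≤
      ∑ x ∈ X, ((1 - a) * (Y.card : ℝ) + (if (1 - a) * (Y.card : ℝ) < ((Y.filter fun y => e x y).card : ℝ)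
        then a * (Y.card : ℝ) else 0)) := by
    apply Finset.sum_le_sum
    intro x _
    have : ((Y.filter fun y => e x y).card : ℝ) ≤ (Y.card : ℝ) := by
      exact_mod_cast Finset.card_filter_le _ _
    split_ifs with hh
    · linarith
    · linarith
  rw [Finset.sum_add_distrib, ← Finset.sum_filter, Finset.sum_const, Finset.sum_const,
    nsmul_eq_mul, nsmul_eq_mul, ← hG] at h1
  have h2 : (a + b - 1) * (X.card : ℝ) * (Y.card : ℝ) ≤ (G.card : ℝ) * a * (Y.card : ℝ) := by
    nlinarith
  have h3 := le_of_mul_le_mul_right h2 hy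
  rw [div_mul_eq_mul_div, div_le_iff₀ ha]
  exact h3

/-- The core five-index argument. -/
lemma aux_core (E : ℕ → ℕ → ℕ → Prop) (s1 : ∀ a b c, E a b c → E b a c)
    (s2 : ∀ a b c, E a b c → E a c b)
    (R1 R2 R3 R4 R5 B1 B2 B3 B4 B5 : Finset ℕ) (a b : ℝ) (ha : 0 < a) (hb : 0 < b)
    (h1 : 2 < a + 2 * b) (h2 : 1 < a + b) (h3 : 1 < (a + b - 1) / a + (b + a - 1) / b)
    (nR1 : R1.Nonempty) (nR2 : R2.Nonempty) (nR3 : R3.Nonempty) (nR4 : R4.Nonempty)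
    (nR5 : R5.Nonempty) (nB1 : B1.Nonempty) (nB2 : B2.Nonempty) (nB3 : B3.Nonempty)
    (nB4 : B4.Nonempty) (nB5 : B5.Nonempty)
    (e1 : ∀ x ∈ R3, ∀ y ∈ R4, a * (B1.card : ℝ) ≤ ((B1.filter fun z => E x y z).card : ℝ))
    (e2 : ∀ x ∈ R4, ∀ y ∈ R5, a * (B2.card : ℝ) ≤ ((B2.filter fun z => E x y z).card : ℝ))
    (e3 : ∀ x ∈ R5, ∀ y ∈ R1, a * (B3.card : ℝ) ≤ ((B3.filter fun z => E x y z).card : ℝ))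
    (e4 : ∀ x ∈ R1, ∀ y ∈ R2, a * (B4.card : ℝ) ≤ ((B4.filter fun z => E x y z).card : ℝ))
    (e5 : ∀ x ∈ R2, ∀ y ∈ R3, a * (B5.card : ℝ) ≤ ((B5.filter fun z => E x y z).card : ℝ))
    (f1 : ∀ x ∈ B2, ∀ y ∈ B5, b * (R1.card : ℝ) ≤ ((R1.filter fun z => E x y z).card : ℝ))
    (f2 : ∀ x ∈ B1, ∀ y ∈ B3, b * (R2.card : ℝ) ≤ ((R2.filter fun z => E x y z).card : ℝ))
    (f3 : ∀ x ∈ B2, ∀ y ∈ B4, b * (R3.card : ℝ) ≤ ((R3.filter fun z => E x y z).card : ℝ))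
    (f4 : ∀ x ∈ B3, ∀ y ∈ B5, b * (R4.card : ℝ) ≤ ((R4.filter fun z => E x y z).card : ℝ))
    (f5 : ∀ x ∈ B1, ∀ y ∈ B4, b * (R5.card : ℝ) ≤ ((R5.filter fun z => E x y z).card : ℝ)) :
    ∃ r1 ∈ R1, ∃ r2 ∈ R2, ∃ r3 ∈ R3, ∃ r4 ∈ R4, ∃ r5 ∈ R5,
    ∃ b1 ∈ B1, ∃ b2 ∈ B2, ∃ b3 ∈ B3, ∃ b4 ∈ B4, ∃ b5 ∈ B5,
      E r3 r4 b1 ∧ E r4 r5 b2 ∧ E r5 r1 b3 ∧ E r1 r2 b4 ∧ E r2 r3 b5 ∧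
      E b2 b5 r1 ∧ E b1 b3 r2 ∧ E b2 b4 r3 ∧ E b3 b5 r4 ∧ E b1 b4 r5 := by
  -- choice of `r1`
  obtain ⟨r1, hr1, hr1g⟩ := aux_exists R1 B5 nR1
    (fun x y => (1 - a) * (B2.card : ℝ) < ((B2.filter fun z => E z y x).card : ℝ))
    ((a + b - 1) / a) (fun y hy => aux_good R1 B2 nB2 (fun x z => E z y x) a b ha
      (fun z hz => f1 z hz y hy))
  -- every `r2` admits a suitable `b5`
  have hb5 : ∀ r2 ∈ R2, ∃ b5 ∈ B5,
      (1 - a) * (B2.card : ℝ) < ((B2.filter fun z => E z b5 r1).card : ℝ) ∧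
      (1 - b) * (R3.card : ℝ) < ((R3.filter fun z => E r2 z b5).card : ℝ) := by
    intro r2 hr2
    have hg := aux_good B5 R3 nR3 (fun x z => E r2 z x) b a hb (fun z hz => e5 r2 hr2 z hz)
    have hpos : (0 : ℝ) < (B5.card : ℝ) := by exact_mod_cast nB5.card_pos
    refine aux_inter2 B5 _ _ ((a + b - 1) / a) (1 - (a + b - 1) / a) hr1g ?_ (by linarith)
    refine lt_of_lt_of_le ?_ hg
    nlinarith
  -- choice of `b3`, `b4` depending on `r5`, `r2`
  have ex : ∀ (B : Finset ℕ) (p : ℕ → Prop), B.Nonempty →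
      a * (B.card : ℝ) ≤ ((B.filter p).card : ℝ) → ∃ z ∈ B, p z := by
    intro B p hB h
    have hpos : (0 : ℝ) < (B.card : ℝ) := by exact_mod_cast hB.card_pos
    have : (0 : ℝ) < ((B.filter p).card : ℝ) := lt_of_lt_of_le (by positivity) h
    obtain ⟨z, hz⟩ := Finset.card_pos.1 (by exact_mod_cast this)
    exact ⟨z, (Finset.mem_filter.1 hz).1, (Finset.mem_filter.1 hz).2⟩
  have hb3 : ∀ r5, ∃ b3, r5 ∈ R5 → b3 ∈ B3 ∧ E r5 r1 b3 := by
    intro r5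
    by_cases h : r5 ∈ R5
    · obtain ⟨z, hz, hz'⟩ := ex B3 _ nB3 (e3 r5 h r1 hr1)
      exact ⟨z, fun _ => ⟨hz, hz'⟩⟩
    · exact ⟨0, fun h' => absurd h' h⟩
  have hb4 : ∀ r2, ∃ b4, r2 ∈ R2 → b4 ∈ B4 ∧ E r1 r2 b4 := by
    intro r2
    by_cases h : r2 ∈ R2
    · obtain ⟨z, hz, hz'⟩ := ex B4 _ nB4 (e4 r1 hr1 r2 h)
      exact ⟨z, fun _ => ⟨hz, hz'⟩⟩
    · exact ⟨0, fun h' => absurd h' h⟩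
  choose g3 hg3 using hb3
  choose g4 hg4 using hb4
  have hX : ∀ r5 ∈ R5, (R2.card : ℝ) * (b * (B1.card : ℝ)) ≤
      ∑ r2 ∈ R2, ((B1.filter fun z => E z (g3 r5) r2).card : ℝ) := fun r5 hr5 =>
    aux_dc R2 B1 (fun x z => E z (g3 r5) x) b (fun z hz => f2 z hz _ (hg3 r5 hr5).1)
  have hY : ∀ r2 ∈ R2, (R5.card : ℝ) * (b * (B1.card : ℝ)) ≤
      ∑ r5 ∈ R5, ((B1.filter fun z => E z (g4 r2) r5).card : ℝ) := fun r2 hr2 =>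
    aux_dc R5 B1 (fun x z => E z (g4 r2) x) b (fun z hz => f5 z hz _ (hg4 r2 hr2).1)
  have hXY : ∃ p ∈ R2 ×ˢ R5, 2 * b * (B1.card : ℝ) ≤
      ((B1.filter fun z => E z (g3 p.2) p.1).card : ℝ) +
      ((B1.filter fun z => E z (g4 p.1) p.2).card : ℝ) := by
    apply Finset.exists_le_of_sum_le (nR2.product nR5)
    rw [Finset.sum_const, nsmul_eq_mul, Finset.card_product, Finset.sum_add_distrib,
      Finset.sum_product_right, Finset.sum_product]
    have k1 := Finset.sum_le_sum hX
    have k2 := Finset.sum_le_sum hY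
    rw [Finset.sum_const, nsmul_eq_mul] at k1 k2
    push_cast
    linarith
  obtain ⟨⟨r2, r5⟩, hp, hsum⟩ := hXY
  obtain ⟨hr2, hr5⟩ := Finset.mem_product.1 hp
  simp only at hr2 hr5 hsum
  obtain ⟨hb3, E3⟩ := hg3 r5 hr5
  obtain ⟨hb4, E4⟩ := hg4 r2 hr2
  set b3 := g3 r5
  set b4 := g4 r2
  obtain ⟨b5, hb5, hb5a, hb5b⟩ := hb5 r2 hr2
  have exb : ∃ z ∈ R4, E b3 b5 z := by
    have h := f4 b3 hb3 b5 hb5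
    have hpos : (0 : ℝ) < (R4.card : ℝ) := by exact_mod_cast nR4.card_pos
    have : (0 : ℝ) < ((R4.filter fun z => E b3 b5 z).card : ℝ) := lt_of_lt_of_le (by positivity) h
    obtain ⟨z, hz⟩ := Finset.card_pos.1 (by exact_mod_cast this)
    exact ⟨z, (Finset.mem_filter.1 hz).1, (Finset.mem_filter.1 hz).2⟩
  obtain ⟨r4, hr4, F4⟩ := exb
  obtain ⟨b2, hb2, E2, F1⟩ := aux_inter2 B2 _ _ a (1 - a) (e2 r4 hr4 r5 hr5) hb5a (by linarith)
  obtain ⟨r3, hr3, F3, E5⟩ := aux_inter2 R3 _ _ b (1 - b) (f3 b2 hb2 b4 hb4) hb5b (by linarith)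
  have hB1 : (0 : ℝ) < (B1.card : ℝ) := by exact_mod_cast nB1.card_pos
  obtain ⟨b1, hb1, E1, F2, F5⟩ := aux_inter3 B1 (fun z => E r3 r4 z) (fun z => E z b3 r2)
    (fun z => E z b4 r5) (by
      have := e1 r3 hr3 r4 hr4
      nlinarith)
  exact ⟨r1, hr1, r2, hr2, r3, hr3, r4, hr4, r5, hr5, b1, hb1, b2, hb2, b3, hb3, b4, hb4, b5, hb5,
    E1, E2, E3, E4, E5, F1, F2, F3, F4, F5⟩

/-- Multicolour Ramsey theorem for graphs. -/
lemma aux_ramsey (k : ℕ) : ∀ (n : ℕ) (m : Fin k → ℕ), ∑ t, m t = n →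
    ∃ N : ℕ, ∀ (S : Finset ℕ) (c : ℕ → ℕ → Fin k), (∀ i j, c i j = c j i) → N ≤ S.card →
      ∃ t, ∃ T ⊆ S, T.card = m t ∧ ∀ i ∈ T, ∀ j ∈ T, i ≠ j → c i j = t := by
  intro n
  induction n with
  | zero =>
    intro m hm
    refine ⟨1, fun S c _ hS => ?_⟩
    have hk : Fin k := c 0 0
    refine ⟨hk, ∅, by simp, ?_, by simp⟩
    have := (Finset.sum_eq_zero_iff.1 hm) hk (Finset.mem_univ _)
    simp [this]
  | succ n ih =>
    intro m hm
    by_cases h0 : ∃ t, m t = 0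
    · obtain ⟨t, ht⟩ := h0
      exact ⟨0, fun S c _ _ => ⟨t, ∅, by simp, by simp [ht], by simp⟩⟩
    push Not at h0
    have hdec : ∀ t, ∃ N : ℕ, ∀ (S : Finset ℕ) (c : ℕ → ℕ → Fin k), (∀ i j, c i j = c j i) →
        N ≤ S.card → ∃ t', ∃ T ⊆ S, T.card = (Function.update m t (m t - 1)) t' ∧
          ∀ i ∈ T, ∀ j ∈ T, i ≠ j → c i j = t' := by
      intro t
      apply ih
      have h1 := Finset.sum_update_of_mem (Finset.mem_univ t) m (m t - 1)
      have h2 := Finset.add_sum_erase Finset.univ m (Finset.mem_univ t)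
      rw [Finset.sdiff_singleton_eq_erase] at h1
      have := h0 t
      omega
    choose N hN using hdec
    refine ⟨∑ t, N t + 2, fun S c hc hS => ?_⟩
    obtain ⟨v, hv⟩ : S.Nonempty := Finset.card_pos.1 (by omega)
    have hex : ∃ t, N t ≤ ((S.erase v).filter fun j => c v j = t).card := by
      by_contra hcon
      push Not at hcon
      have h1 : (S.erase v).card = ∑ t, ((S.erase v).filter fun j => c v j = t).card :=
        Finset.card_eq_sum_card_fiberwise (fun _ _ => by simp)
      have h2 : ∑ t, ((S.erase v).filter fun j => c v j = t).card ≤ ∑ t, N t :=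
        Finset.sum_le_sum fun t _ => (hcon t).le
      rw [Finset.card_erase_of_mem hv] at h1
      omega
    obtain ⟨t, ht⟩ := hex
    obtain ⟨t', T, hTS, hT, hTc⟩ := hN t _ c hc ht
    by_cases htt : t' = t
    · subst htt
      have hvT : v ∉ T := fun h => by
        have := hTS h
        simp at this
      refine ⟨t', insert v T, ?_, ?_, ?_⟩
      · intro x hx
        rcases Finset.mem_insert.1 hx with rfl | hx
        · exact hv
        · exact Finset.mem_of_mem_erase (Finset.mem_filter.1 (hTS hx)).1
      · rw [Finset.card_insert_of_notMem hvT, hT, Function.update_self]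
        have := h0 t'
        omega
      · intro i hi j hj hij
        rcases Finset.mem_insert.1 hi with rfl | hi' <;> rcases Finset.mem_insert.1 hj with rfl | hj'
        · exact absurd rfl hij
        · exact (Finset.mem_filter.1 (hTS hj')).2
        · rw [hc]; exact (Finset.mem_filter.1 (hTS hi')).2
        · exact hTc i hi' j hj' hij
    · refine ⟨t', T, ?_, ?_, hTc⟩
      · exact fun x hx => Finset.mem_of_mem_erase (Finset.mem_filter.1 (hTS hx)).1
      · rw [hT, Function.update_of_ne htt]

lemma aux_arith (ε u w : ℝ) (hε : 0 < ε) (hu : 0 < u) (hw : 0 < w) (hu2 : u ≤ 1 / 2)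
    (huw : u + w ≤ 1 + ε) :
    let a := (1 / 3 + ε) / w
    let b := (1 / 3 + ε) / u
    0 < a ∧ 0 < b ∧ 2 < a + 2 * b ∧ 1 < a + b ∧ 1 < (a + b - 1) / a + (b + a - 1) / b := by
  intro a b
  have ha : 0 < a := by positivity
  have hb : 0 < b := by positivity
  have hd : (0 : ℝ) < 1 / 3 + ε := by positivity
  have haw : a * w = 1 / 3 + ε := div_mul_cancel₀ _ hw.ne'
  have hbu : b * u = 1 / 3 + ε := div_mul_cancel₀ _ hu.ne'
  have hb2 : 2 / 3 < b := by
    by_contra h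
    push Not at h
    nlinarith
  have key : a + b < 3 * (a * b) := by
    have : (a + b) * (1 / 3 + ε) = a * b * (u + w) := by
      calc (a + b) * (1 / 3 + ε) = a * (1 / 3 + ε) + b * (1 / 3 + ε) := by ring
        _ = a * (b * u) + b * (a * w) := by rw [haw, hbu]
        _ = _ := by ring
    have hab : 0 < a * b := by positivity
    have h2 : (a + b) * (1 / 3 + ε) < 3 * (a * b) * (1 / 3 + ε) := by
      rw [this]
      have : a * b * (u + w) ≤ a * b * (1 + ε) := by gcongr
      nlinarith
    exact lt_of_mul_lt_mul_right h2 hd.le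
  have hs : 4 / 3 < a + b := by
    by_contra h
    push Not at h
    nlinarith [sq_nonneg (a - b), mul_nonneg (add_pos ha hb).le (sub_nonneg.2 h)]
  refine ⟨ha, hb, ?_, by linarith, ?_⟩
  · by_contra h
    push Not at h
    nlinarith [mul_nonneg (sub_nonneg.2 h) (by linarith : (0:ℝ) ≤ 3 * b - 1),
      mul_nonneg (by linarith : (0:ℝ) ≤ 3 * b - 2) (by linarith : (0:ℝ) ≤ 2 * b - 1)]
  · rw [div_add_div _ _ ha.ne' hb.ne', lt_div_iff₀ (by positivity)]
    nlinarith [sq_nonneg (a - b), mul_pos (add_pos ha hb) (sub_pos.2 hs)]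

lemma aux_fin2 (p : Fin 5 → Fin 5 → Prop) (h01 : p 0 1) (h02 : p 0 2) (h03 : p 0 3)
    (h04 : p 0 4) (h12 : p 1 2) (h13 : p 1 3) (h14 : p 1 4) (h23 : p 2 3) (h24 : p 2 4)
    (h34 : p 3 4) : ∀ x y, x < y → p x y := by
  intro x y h
  fin_cases x <;> fin_cases y <;> first
    | exact absurd h (by decide)
    | assumption

lemma aux_fin3 (p : Fin 5 → Fin 5 → Fin 5 → Prop) (h012 : p 0 1 2) (h013 : p 0 1 3)
    (h014 : p 0 1 4) (h023 : p 0 2 3) (h024 : p 0 2 4) (h034 : p 0 3 4) (h123 : p 1 2 3)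
    (h124 : p 1 2 4) (h134 : p 1 3 4) (h234 : p 2 3 4) : ∀ x y z, x < y → y < z → p x y z := by
  intro x y z h h'
  fin_cases x <;> fin_cases y <;> first
    | exact absurd h (by decide)
    | (fin_cases z <;> first | exact absurd h' (by decide) | assumption)

set_option maxHeartbeats 1000000 in
lemma aux_hom (A : ReducedHG) (φ : ℕ → Bool) (ε u w : ℝ) (hε : 0 < ε) (hbi : A.IsBicolouring φ)
    (htau : A.Tau2Ge φ (1/3 + ε)) (J : Finset ℕ) (hJ : J ⊆ A.I) (hJ5 : J.card = 5) (c : Bool)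
    (hu : ∀ i ∈ J, ∀ j ∈ J, i ≠ j →
      (((A.P i j).filter fun v => φ v = c).card : ℝ) ≤ u * ((A.P i j).card : ℝ))
    (hw : ∀ i ∈ J, ∀ j ∈ J, i ≠ j →
      (((A.P i j).filter fun v => φ v = !c).card : ℝ) ≤ w * ((A.P i j).card : ℝ))
    (hu2 : u ≤ 1 / 2) (huw : u + w ≤ 1 + ε) : A.SupportsK5 := by
  obtain ⟨e⟩ : Nonempty (Fin 5 ≃ J) := by
    have : Fintype.card J = 5 := by simpa using hJ5
    exact ⟨(Fintype.equivFinOfCardEq this).symm⟩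
  have ne : ∀ x y : Fin 5, x ≠ y → ((e x : ℕ)) ≠ (e y : ℕ) := fun x y h h' =>
    h (e.injective (Subtype.ext h'))
  have nonempty : ∀ x y : Fin 5, x ≠ y → ∀ d : Bool,
      ((A.P (e x) (e y)).filter fun v => φ v = d).Nonempty := by
    intro x y hxy d
    obtain ⟨⟨v, hv, hv'⟩, ⟨z, hz, hz'⟩⟩ := hbi.1 _ (hJ (e x).2) _ (hJ (e y).2) (ne x y hxy)
    cases d
    · exact ⟨z, by simp [hz, hz']⟩
    · exact ⟨v, by simp [hv, hv']⟩
  have pos : ∀ s : ℝ, ∀ d : Bool, (((A.P (e 0) (e 1)).filter fun v => φ v = d).card : ℝ)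
      ≤ s * ((A.P (e 0) (e 1)).card : ℝ) → 0 < s := by
    intro s d h
    have h1 : (0 : ℝ) < (((A.P (e 0) (e 1)).filter fun v => φ v = d).card : ℝ) := by
      exact_mod_cast (nonempty 0 1 (by decide) d).card_pos
    by_contra hs
    push Not at hs
    have : s * ((A.P (e 0) (e 1)).card : ℝ) ≤ 0 := mul_nonpos_of_nonpos_of_nonneg hs (by positivity)
    linarith
  have hu0 : 0 < u := pos u c (hu _ (e 0).2 _ (e 1).2 (ne 0 1 (by decide)))
  have hw0 : 0 < w := pos w (!c) (hw _ (e 0).2 _ (e 1).2 (ne 0 1 (by decide)))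
  have nb : ∀ x y z : Fin 5, x ≠ y → x ≠ z → y ≠ z → ∀ d d' : Bool, d' = (!d) → ∀ s : ℝ, 0 < s →
      (((A.P (e y) (e z)).filter fun v => φ v = d').card : ℝ) ≤ s * ((A.P (e y) (e z)).card : ℝ) →
      ∀ p ∈ (A.P (e x) (e y)).filter fun v => φ v = d,
      ∀ q ∈ (A.P (e x) (e z)).filter fun v => φ v = d,
      (1 / 3 + ε) / s * (((A.P (e y) (e z)).filter fun v => φ v = d').card : ℝ) ≤
        ((((A.P (e y) (e z)).filter fun v => φ v = d').filter fun v => A.Edge p q v).card : ℝ) := by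
    intro x y z hxy hxz hyz d d' hd s hs hcard p hp q hq
    obtain ⟨hp, hpd⟩ := Finset.mem_filter.1 hp
    obtain ⟨hq, hqd⟩ := Finset.mem_filter.1 hq
    have h1 := htau _ _ _ (hJ (e x).2) (hJ (e y).2) (hJ (e z).2) (ne x y hxy) (ne x z hxz)
      (ne y z hyz) p hp q hq (hpd.trans hqd.symm)
    have h2 : A.nbhd (e y) (e z) p q ⊆
        ((A.P (e y) (e z)).filter fun v => φ v = d').filter fun v => A.Edge p q v := by
      intro v hv
      obtain ⟨hv, hve⟩ := Finset.mem_filter.1 hv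
      have := hbi.2 p q v hve
      refine Finset.mem_filter.2 ⟨Finset.mem_filter.2 ⟨hv, ?_⟩, hve⟩
      rw [hpd, hqd] at this
      subst hd
      have h3 : ¬ d = φ v := fun h => this ⟨rfl, h⟩
      cases d <;> cases h : φ v <;> simp_all
    have h3 : ((A.nbhd (e y) (e z) p q).card : ℝ) ≤
        ((((A.P (e y) (e z)).filter fun v => φ v = d').filter fun v => A.Edge p q v).card : ℝ) := by
      exact_mod_cast Finset.card_le_card h2
    refine le_trans ?_ (h1.trans h3)
    rw [div_mul_eq_mul_div, div_le_iff₀ hs]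
    have : (0 : ℝ) ≤ 1 / 3 + ε := by positivity
    calc _ ≤ (1 / 3 + ε) * (s * ((A.P (e y) (e z)).card : ℝ)) := by gcongr
      _ = _ := by ring
  obtain ⟨ha, hb, k1, k2, k3⟩ := aux_arith ε u w hε hu0 hw0 hu2 huw
  have nbR : ∀ x y z : Fin 5, x ≠ y → x ≠ z → y ≠ z →
      ∀ p ∈ (A.P (e x) (e y)).filter fun v => φ v = c,
      ∀ q ∈ (A.P (e x) (e z)).filter fun v => φ v = c,
      (1 / 3 + ε) / w * (((A.P (e y) (e z)).filter fun v => φ v = !c).card : ℝ) ≤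
        ((((A.P (e y) (e z)).filter fun v => φ v = !c).filter fun v => A.Edge p q v).card : ℝ) :=
    fun x y z h1 h2 h3 => nb x y z h1 h2 h3 c (!c) rfl w hw0 (hw _ (e y).2 _ (e z).2 (ne y z h3))
  have nbB : ∀ x y z : Fin 5, x ≠ y → x ≠ z → y ≠ z →
      ∀ p ∈ (A.P (e x) (e y)).filter fun v => φ v = !c,
      ∀ q ∈ (A.P (e x) (e z)).filter fun v => φ v = !c,
      (1 / 3 + ε) / u * (((A.P (e y) (e z)).filter fun v => φ v = c).card : ℝ) ≤
        ((((A.P (e y) (e z)).filter fun v => φ v = c).filter fun v => A.Edge p q v).card : ℝ) :=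
    fun x y z h1 h2 h3 => nb x y z h1 h2 h3 (!c) c (by simp) u hu0
      (hu _ (e y).2 _ (e z).2 (ne y z h3))
  let Q : Bool → Fin 5 → Fin 5 → Finset ℕ := fun d x y => (A.P (e x) (e y)).filter fun v => φ v = d
  have Qs : ∀ d x y, Q d x y = Q d y x := fun d x y => by
    simp only [Q]; rw [A.Psymm]
  have nbR' : ∀ x y z : Fin 5, x ≠ y → x ≠ z → y ≠ z → ∀ p ∈ Q c x y, ∀ q ∈ Q c x z,
      (1 / 3 + ε) / w * ((Q (!c) y z).card : ℝ) ≤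
        (((Q (!c) y z).filter fun v => A.Edge p q v).card : ℝ) := nbR
  have nbB' : ∀ x y z : Fin 5, x ≠ y → x ≠ z → y ≠ z → ∀ p ∈ Q (!c) x y, ∀ q ∈ Q (!c) x z,
      (1 / 3 + ε) / u * ((Q c y z).card : ℝ) ≤
        (((Q c y z).filter fun v => A.Edge p q v).card : ℝ) := nbB
  have nQ : ∀ x y : Fin 5, x ≠ y → ∀ d, (Q d x y).Nonempty := nonempty
  have memQ : ∀ d x y v, v ∈ Q d x y → v ∈ A.P (e x) (e y) := fun d x y v h =>
    (Finset.mem_filter.1 h).1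
  obtain ⟨r1, hr1, r2, hr2, r3, hr3, r4, hr4, r5, hr5, b1, hb1, b2, hb2, b3, hb3, b4, hb4, b5, hb5,
      E1, E2, E3, E4, E5, F1, F2, F3, F4, F5⟩ :=
    aux_core A.Edge A.EdgeSymm A.EdgeSymm' (Q c 2 3) (Q c 3 4) (Q c 4 0) (Q c 0 1) (Q c 1 2)
      (Q (!c) 4 1) (Q (!c) 0 2) (Q (!c) 1 3) (Q (!c) 2 4) (Q (!c) 3 0)
      ((1 / 3 + ε) / w) ((1 / 3 + ε) / u) ha hb k1 k2 k3
      (nQ _ _ (by decide) _) (nQ _ _ (by decide) _) (nQ _ _ (by decide) _) (nQ _ _ (by decide) _)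
      (nQ _ _ (by decide) _) (nQ _ _ (by decide) _) (nQ _ _ (by decide) _) (nQ _ _ (by decide) _)
      (nQ _ _ (by decide) _) (nQ _ _ (by decide) _)
      (by rw [Qs c 4 0]; exact nbR' 0 4 1 (by decide) (by decide) (by decide))
      (by rw [Qs c 0 1]; exact nbR' 1 0 2 (by decide) (by decide) (by decide))
      (by rw [Qs c 1 2]; exact nbR' 2 1 3 (by decide) (by decide) (by decide))
      (by rw [Qs c 2 3]; exact nbR' 3 2 4 (by decide) (by decide) (by decide))
      (by rw [Qs c 3 4]; exact nbR' 4 3 0 (by decide) (by decide) (by decide))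
      (by rw [Qs (!c) 3 0]; exact nbB' 0 2 3 (by decide) (by decide) (by decide))
      (by rw [Qs (!c) 4 1, Qs c 3 4]; exact nbB' 1 4 3 (by decide) (by decide) (by decide))
      (by rw [Qs (!c) 0 2, Qs c 4 0]; exact nbB' 2 0 4 (by decide) (by decide) (by decide))
      (by rw [Qs (!c) 1 3, Qs c 0 1]; exact nbB' 3 1 0 (by decide) (by decide) (by decide))
      (by rw [Qs (!c) 2 4]; exact nbB' 4 1 2 (by decide) (by decide) (by decide))
  let g : Fin 5 → Fin 5 → ℕ := ![![0, r4, b2, b5, r3], ![r4, 0, r5, b3, b1], ![b2, r5, 0, r1, b4],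
    ![b5, b3, r1, 0, r2], ![r3, b1, b4, r2, 0]]
  have gs : ∀ x y, g x y = g y x := by
    intro x y
    fin_cases x <;> fin_cases y <;> rfl
  have gP : ∀ x y, x < y → g x y ∈ A.P (e x) (e y) := by
    rw [Qs] at hb1 hb5 hr3
    exact aux_fin2 (fun x y => g x y ∈ A.P (e x) (e y)) (memQ _ _ _ _ hr4) (memQ _ _ _ _ hb2)
      (memQ _ _ _ _ hb5) (memQ _ _ _ _ hr3) (memQ _ _ _ _ hr5) (memQ _ _ _ _ hb3)
      (memQ _ _ _ _ hb1) (memQ _ _ _ _ hr1) (memQ _ _ _ _ hb4) (memQ _ _ _ _ hr2)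
  have gP' : ∀ x y, x ≠ y → g x y ∈ A.P (e x) (e y) := by
    intro x y hxy
    rcases lt_or_gt_of_ne hxy with h | h
    · exact gP x y h
    · rw [gs, A.Psymm]; exact gP y x h
  have s1 := A.EdgeSymm
  have s2 := A.EdgeSymm'
  have gE : ∀ x y z, x < y → y < z → A.Edge (g x y) (g x z) (g y z) := by
    have perm : ∀ p q r, A.Edge p q r → A.Edge p r q ∧ A.Edge q p r ∧ A.Edge q r p ∧
        A.Edge r p q ∧ A.Edge r q p := fun p q r h =>
      ⟨s2 _ _ _ h, s1 _ _ _ h, s2 _ _ _ (s1 _ _ _ h), s1 _ _ _ (s2 _ _ _ h),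
        s2 _ _ _ (s1 _ _ _ (s2 _ _ _ h))⟩
    have E1' := perm _ _ _ E1
    have E2' := perm _ _ _ E2
    have E3' := perm _ _ _ E3
    have E4' := perm _ _ _ E4
    have E5' := perm _ _ _ E5
    have F1' := perm _ _ _ F1
    have F2' := perm _ _ _ F2
    have F3' := perm _ _ _ F3
    have F4' := perm _ _ _ F4
    have F5' := perm _ _ _ F5
    have t012 : A.Edge r4 b2 r5 := by tauto
    have t013 : A.Edge r4 b5 b3 := by tauto
    have t014 : A.Edge r4 r3 b1 := by tauto
    have t023 : A.Edge b2 b5 r1 := by tauto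
    have t024 : A.Edge b2 r3 b4 := by tauto
    have t034 : A.Edge b5 r3 r2 := by tauto
    have t123 : A.Edge r5 b3 r1 := by tauto
    have t124 : A.Edge r5 b1 b4 := by tauto
    have t134 : A.Edge b3 b1 r2 := by tauto
    have t234 : A.Edge r1 b4 r2 := by tauto
    exact aux_fin3 (fun x y z => A.Edge (g x y) (g x z) (g y z)) t012 t013 t014 t023 t024 t034
      t123 t124 t134 t234
  have gE' : ∀ x y z, x ≠ y → x ≠ z → y ≠ z → A.Edge (g x y) (g x z) (g y z) := by
    intro x y z hxy hxz hyz
    rcases lt_or_gt_of_ne hxy with h1 | h1 <;> rcases lt_or_gt_of_ne hxz with h2 | h2 <;>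
      rcases lt_or_gt_of_ne hyz with h3 | h3
    · exact gE x y z h1 h3
    · rw [gs y z]; exact s1 _ _ _ (gE x z y h2 h3)
    · exact absurd (h1.trans h3) (not_lt.2 h2.le)
    · rw [gs x z, gs y z]; exact s1 _ _ _ (s2 _ _ _ (gE z x y h2 h1))
    · rw [gs x y]; exact s2 _ _ _ (gE y x z h1 h2)
    · exact absurd (h2.trans h3) (not_lt.2 h1.le)
    · rw [gs x y, gs x z]; exact s2 _ _ _ (s1 _ _ _ (gE y z x h3 h2))
    · rw [gs x y, gs x z, gs y z]
      exact s2 _ _ _ (s1 _ _ _ (s2 _ _ _ (gE z y x h3 h1)))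
  let inv : ℕ → Fin 5 := fun i => if h : i ∈ J then e.symm ⟨i, h⟩ else 0
  have hinv : ∀ i ∈ J, (e (inv i) : ℕ) = i := by
    intro i hi
    simp [inv, hi]
  have inv_ne : ∀ i ∈ J, ∀ j ∈ J, i ≠ j → inv i ≠ inv j := by
    intro i hi j hj hij h
    apply hij
    rw [← hinv i hi, ← hinv j hj, h]
  refine ⟨J, hJ, hJ5, fun i j => g (inv i) (inv j), fun i _ j _ => gs _ _, ?_, ?_⟩
  · intro i hi j hj hij
    have := gP' _ _ (inv_ne i hi j hj hij)
    rwa [hinv i hi, hinv j hj] at this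
  · intro i hi j hj k hk hij hik hjk
    exact gE' _ _ _ (inv_ne i hi j hj hij) (inv_ne i hi k hk hik) (inv_ne j hj k hk hjk)

end helpers

/-- Proposition 6 (`prop:bicolored`): every sufficiently large bicoloured reduced hypergraph
with `τ₂(𝒜, φ) ≥ 1/3 + ε` supports a `K₅⁽³⁾`. -/
theorem bicoloured_supports_K5 :
    ∀ ε : ℝ, 0 < ε → ∃ n₀ : ℕ, ∀ (A : ReducedHG) (φ : ℕ → Bool),
      n₀ ≤ A.I.card → A.IsBicolouring φ → A.Tau2Ge φ (1/3 + ε) → A.SupportsK5 := by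
  intro ε hε
  obtain ⟨M, hM⟩ := exists_nat_gt (1 / ε)
  have hM0 : (0 : ℝ) < M := lt_trans (by positivity) hM
  obtain ⟨N, hN⟩ := aux_ramsey (2 * M + 1) _ (fun _ => 5) rfl
  refine ⟨N, fun A φ hcard hbi htau => ?_⟩
  let ρ : ℕ → ℕ → ℝ := fun i j =>
    (((A.P i j).filter fun v => φ v = true).card : ℝ) / ((A.P i j).card : ℝ)
  have hρ0 : ∀ i j, 0 ≤ ρ i j := fun i j => by positivity
  have hρ1 : ∀ i j, ρ i j ≤ 1 := fun i j =>
    div_le_one_of_le₀ (by exact_mod_cast Finset.card_filter_le _ _) (by positivity)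
  have hρs : ∀ i j, ρ i j = ρ j i := fun i j => by simp only [ρ]; rw [A.Psymm]
  have hlt : ∀ i j, ⌊2 * (M : ℝ) * ρ i j⌋₊ < 2 * M + 1 := by
    intro i j
    have : ⌊2 * (M : ℝ) * ρ i j⌋₊ ≤ 2 * M := by
      apply Nat.floor_le_of_le
      push_cast
      nlinarith [hρ1 i j]
    omega
  obtain ⟨t, J, hJ, hJ5, hJc⟩ := hN A.I (fun i j => ⟨⌊2 * (M : ℝ) * ρ i j⌋₊, hlt i j⟩)
    (fun i j => Fin.ext (by simp only []; rw [hρs i j])) hcard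
  have hb : ∀ i ∈ J, ∀ j ∈ J, i ≠ j →
      ((t : ℕ) : ℝ) ≤ 2 * (M : ℝ) * ρ i j ∧ 2 * (M : ℝ) * ρ i j ≤ ((t : ℕ) : ℝ) + 1 := by
    intro i hi j hj hij
    have h := congrArg Fin.val (hJc i hi j hj hij)
    have h : ⌊2 * (M : ℝ) * ρ i j⌋₊ = (t : ℕ) := h
    rw [← h]
    exact ⟨Nat.floor_le (by have := hρ0 i j; positivity), (Nat.lt_floor_add_one _).le⟩
  have hM2 : (0 : ℝ) < 2 * M := by positivity
  have hcards : ∀ i ∈ J, ∀ j ∈ J, i ≠ j →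
      (((A.P i j).filter fun v => φ v = true).card : ℝ) ≤
        (((t : ℕ) : ℝ) + 1) / (2 * M) * ((A.P i j).card : ℝ) ∧
      (((A.P i j).filter fun v => φ v = false).card : ℝ) ≤
        (1 - ((t : ℕ) : ℝ) / (2 * M)) * ((A.P i j).card : ℝ) := by
    intro i hi j hj hij
    have hP : (0 : ℝ) < ((A.P i j).card : ℝ) := by
      exact_mod_cast (A.Pnonempty i j (hJ hi) (hJ hj) hij).card_pos
    have h1 : (((A.P i j).filter fun v => φ v = true).card : ℝ) = ρ i j * ((A.P i j).card : ℝ) :=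
      (div_mul_cancel₀ _ hP.ne').symm
    have h2 : (((A.P i j).filter fun v => φ v = true).card : ℝ) +
        (((A.P i j).filter fun v => φ v = false).card : ℝ) = ((A.P i j).card : ℝ) := by
      have := Finset.card_filter_add_card_filter_not (s := A.P i j) (fun v => φ v = true)
      have h' : (A.P i j).filter (fun v => ¬ φ v = true) = (A.P i j).filter fun v => φ v = false :=
        Finset.filter_congr fun v _ => by simp
      rw [h'] at this
      exact_mod_cast this
    obtain ⟨h3, h4⟩ := hb i hi j hj hij
    have h5 : ρ i j ≤ (((t : ℕ) : ℝ) + 1) / (2 * M) := by rw [le_div_iff₀ hM2]; linarith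
    have h6 : ((t : ℕ) : ℝ) / (2 * M) ≤ ρ i j := by rw [div_le_iff₀ hM2]; linarith
    constructor
    · rw [h1]; exact mul_le_mul_of_nonneg_right h5 hP.le
    · nlinarith
  have hsum : 1 / (2 * (M : ℝ)) ≤ ε := by
    rw [div_le_iff₀ hM2]
    rw [div_lt_iff₀ hε] at hM
    nlinarith
  have hadd : (((t : ℕ) : ℝ) + 1) / (2 * M) + (1 - ((t : ℕ) : ℝ) / (2 * M)) ≤ 1 + ε := by
    rw [add_div]; linarith
  by_cases ht : (t : ℕ) + 1 ≤ M
  · refine aux_hom A φ ε _ _ hε hbi htau J hJ hJ5 true (fun i hi j hj h => (hcards i hi j hj h).1)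
      (fun i hi j hj h => (hcards i hi j hj h).2) ?_ hadd
    have : ((t : ℕ) : ℝ) + 1 ≤ M := by exact_mod_cast ht
    rw [div_le_iff₀ hM2]; linarith
  · refine aux_hom A φ ε _ _ hε hbi htau J hJ hJ5 false (fun i hi j hj h => (hcards i hi j hj h).2)
      (fun i hi j hj h => (hcards i hi j hj h).1) ?_ (by linarith)
    have : (M : ℝ) ≤ ((t : ℕ) : ℝ) := by exact_mod_cast (by omega : M ≤ (t : ℕ))
    have : 1 / 2 ≤ ((t : ℕ) : ℝ) / (2 * M) := by rw [le_div_iff₀ hM2]; linarith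
    linarith
end
end

section
/- For all t ∈ ℕ and μ > 0 there is μ' > 0 such that the following holds for every sufficiently large index set: if 𝒜 is a (μ,vvv)-dense reduced hypergraph with index set I, and for all i < j < k in I sets of left cherries ℒ^{ijk} ⊆ 𝒫^{ij}×𝒫^{ik} and right cherries ℛ^{ijk} ⊆ 𝒫^{ik}×𝒫^{jk} are given satisfying |ℒ^{ijk}| ≤ μ'|𝒫^{ij}||𝒫^{ik}| and |ℛ^{ijk}| ≤ μ'|𝒫^{ik}||𝒫^{jk}|, then there exist a set I⋆ ⊆ I of size t and an inhabited triple of I⋆-transversals 𝒬, ℛ, 𝒮, each of which avoids the cherry sets ℒ^{ijk} and ℛ^{ijk} for every ijk ∈ I⋆⁽³⁾. -/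
open Finset Classical

noncomputable section

lemma ramsey_aux (r : ℕ) (ih : ∀ m : ℕ, ∃ N : ℕ, ∀ X : Finset ℕ, N ≤ X.card → ∀ c : Finset ℕ → Prop,
      ∃ H ⊆ X, H.card = m ∧ ((∀ e ⊆ H, e.card = r → c e) ∨ (∀ e ⊆ H, e.card = r → ¬ c e))) :
    ∀ n p q : ℕ, p + q = n → ∃ N : ℕ, ∀ X : Finset ℕ, N ≤ X.card → ∀ c : Finset ℕ → Prop,
      (∃ H ⊆ X, H.card = p ∧ ∀ e ⊆ H, e.card = r + 1 → c e) ∨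
      (∃ H ⊆ X, H.card = q ∧ ∀ e ⊆ H, e.card = r + 1 → ¬ c e) := by
  intro n
  induction n with
  | zero =>
    intro p q h
    refine ⟨0, fun X _ c => Or.inl ⟨∅, by simp, by simp; omega, ?_⟩⟩
    intro e he hc
    simp at he
    simp [he] at hc
  | succ n ihn =>
    intro p q h
    rcases Nat.eq_zero_or_pos p with hp | hp
    · refine ⟨0, fun X _ c => Or.inl ⟨∅, by simp, by simp; omega, ?_⟩⟩
      intro e he hc
      simp at he
      simp [he] at hc
    rcases Nat.eq_zero_or_pos q with hq | hq
    · refine ⟨0, fun X _ c => Or.inr ⟨∅, by simp, by simp; omega, ?_⟩⟩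
      intro e he hc
      simp at he
      simp [he] at hc
    obtain ⟨N1, h1⟩ := ihn (p - 1) q (by omega)
    obtain ⟨N2, h2⟩ := ihn p (q - 1) (by omega)
    obtain ⟨N, hN⟩ := ih (max N1 N2)
    refine ⟨N + 1, fun X hX c => ?_⟩
    obtain ⟨x, hx⟩ : X.Nonempty := card_pos.mp (by omega)
    obtain ⟨Y, hYX, hYc, hY⟩ := hN (X.erase x) (by rw [card_erase_of_mem hx]; omega)
      (fun e => c (insert x e))
    have hxY : x ∉ Y := fun h => by simpa using hYX h
    have hYX' : Y ⊆ X := hYX.trans (erase_subset _ _)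
    have key : ∀ (H : Finset ℕ) (d : Finset ℕ → Prop), H ⊆ Y →
        (∀ e ⊆ Y, e.card = r → d (insert x e)) → (∀ e ⊆ H, e.card = r + 1 → d e) →
        ∀ e ⊆ insert x H, e.card = r + 1 → d e := by
      intro H d hH hd hd' e he hec
      by_cases hxe : x ∈ e
      · have := hd (e.erase x) ((by grind : e.erase x ⊆ H).trans hH)
          (by rw [card_erase_of_mem hxe]; omega)
        rwa [insert_erase hxe] at this
      · exact hd' e (by grind) hec
    rcases hY with hY | hY
    · rcases h1 Y (by rw [hYc]; exact le_max_left _ _) c with ⟨H, hH, hHc, hHe⟩ | ⟨H, hH, hHc, hHe⟩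
      · refine Or.inl ⟨insert x H, by grind, ?_, key H c hH hY hHe⟩
        rw [card_insert_of_notMem (fun h => hxY (hH h))]; omega
      · exact Or.inr ⟨H, hH.trans hYX', hHc, hHe⟩
    · rcases h2 Y (by rw [hYc]; exact le_max_right _ _) c with ⟨H, hH, hHc, hHe⟩ | ⟨H, hH, hHc, hHe⟩
      · exact Or.inl ⟨H, hH.trans hYX', hHc, hHe⟩
      · refine Or.inr ⟨insert x H, by grind, ?_, key H (fun e => ¬ c e) hH hY hHe⟩
        rw [card_insert_of_notMem (fun h => hxY (hH h))]; omega

lemma ramsey_hyp (r : ℕ) : ∀ m : ℕ, ∃ N : ℕ, ∀ X : Finset ℕ, N ≤ X.card → ∀ c : Finset ℕ → Prop,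
      ∃ H ⊆ X, H.card = m ∧ ((∀ e ⊆ H, e.card = r → c e) ∨ (∀ e ⊆ H, e.card = r → ¬ c e)) := by
  induction r with
  | zero =>
    intro m
    refine ⟨m, fun X hX c => ?_⟩
    obtain ⟨H, hH, hc⟩ := exists_subset_card_eq hX
    refine ⟨H, hH, hc, ?_⟩
    by_cases h : c ∅
    · left; intro e _ he; rw [card_eq_zero] at he; rwa [he]
    · right; intro e _ he; rw [card_eq_zero] at he; rwa [he]
  | succ r ih =>
    intro m
    obtain ⟨N, hN⟩ := ramsey_aux r ih _ m m rfl
    refine ⟨N, fun X hX c => ?_⟩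
    rcases hN X hX c with ⟨H, a, b, d⟩ | ⟨H, a, b, d⟩
    · exact ⟨H, a, b, Or.inl d⟩
    · exact ⟨H, a, b, Or.inr d⟩

lemma spaced (t : ℕ) (H : Finset ℕ) (hH : H.card = (t + 1) * (t + 1)) :
    ∃ J ⊆ H, J.card = t ∧ ∀ a ∈ J, ∀ b ∈ J, a < b →
      t ≤ (H.filter fun x => x < a).card ∧ t ≤ (H.filter fun x => a < x ∧ x < b).card ∧
      t ≤ (H.filter fun x => b < x).card := by
  set f := H.orderEmbOfFin hH with hf
  have hmem : ∀ i, f i ∈ H := fun i => H.orderEmbOfFin_mem hH i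
  have hlt : ∀ l : Fin t, (l.1 + 1) * (t + 1) + t < (t + 1) * (t + 1) := by
    intro l
    have h1 : l.1 + 1 ≤ t := l.2
    nlinarith
  let g : Fin t → ℕ := fun l => f ⟨(l.1 + 1) * (t + 1), by have := hlt l; omega⟩
  -- counting
  have cnt : ∀ (s : ℕ) (hs : s + t ≤ (t + 1) * (t + 1)) (p : ℕ → Prop) (_ : DecidablePred p),
      (∀ i : Fin t, p (f ⟨s + i.1, by omega⟩)) → t ≤ (H.filter p).card := by
    intro s hs p _ hp
    have := card_le_card_of_injOn (s := (univ : Finset (Fin t))) (t := H.filter p)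
      (fun i => f ⟨s + i.1, by omega⟩) (by
        intro i _
        simp only [coe_filter, Set.mem_ofPred_eq]
        exact ⟨hmem _, hp i⟩)
      (by
        intro i _ j _ h
        have := f.injective h
        simp at this
        exact Fin.ext this)
    simpa using this
  have ginj : Function.Injective g := by
    intro i j h
    have := f.injective h
    simp at this
    exact Fin.ext this
  refine ⟨univ.image g, ?_, ?_, ?_⟩
  · intro x hx
    simp only [mem_image, mem_univ, true_and] at hx
    obtain ⟨l, rfl⟩ := hx
    exact hmem _
  · rw [card_image_of_injective _ ginj]; simp
  · intro a ha b hb hab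
    simp only [mem_image, mem_univ, true_and] at ha hb
    obtain ⟨l, rfl⟩ := ha
    obtain ⟨l', rfl⟩ := hb
    have hll : (l.1 + 1) * (t + 1) < (l'.1 + 1) * (t + 1) := by
      exact f.lt_iff_lt.mp hab
    have hll' : l.1 + 1 ≤ l'.1 := by
      have := Nat.lt_of_mul_lt_mul_right hll
      omega
    have e1 := hlt l
    have e2 := hlt l'
    have e3 : (l.1 + 1) * (t + 1) + (t + 1) ≤ (l'.1 + 1) * (t + 1) := by nlinarith
    have e4 : t + 1 ≤ (l.1 + 1) * (t + 1) := by nlinarith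
    refine ⟨cnt 0 (by omega) _ _ ?_, cnt ((l.1 + 1) * (t + 1) + 1) (by omega) _ _ ?_,
      cnt ((l'.1 + 1) * (t + 1) + 1) (by omega) _ _ ?_⟩
    · intro i
      apply f.lt_iff_lt.mpr
      simp only [Fin.lt_def]; omega
    · intro i
      constructor <;> apply f.lt_iff_lt.mpr <;> simp only [Fin.lt_def] <;> omega
    · intro i
      apply f.lt_iff_lt.mpr
      simp only [Fin.lt_def]; omega

/-- averaging -/
lemma popular {α : Type*} (P : Finset α) (X : Finset ℕ) (E : ℕ → α → Prop) (δ : ℝ) (s : ℕ)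
    (hδ : 0 < δ) (hX : (2 * s : ℝ) ≤ δ * X.card) (hE : ∀ x ∈ X, δ * P.card ≤ ((P.filter (E x)).card : ℝ))
    (hX0 : X.Nonempty) (hP0 : P.Nonempty) :
    ∃ J ⊆ X, J.card = s ∧
      δ / 2 / 2 ^ X.card * (P.card : ℝ) ≤ ((P.filter fun v => ∀ x ∈ J, E x v).card : ℝ) := by
  by_contra hcon
  push Not at hcon
  set d : α → ℕ := fun v => (X.filter fun x => E x v).card with hd
  have h1 : δ * X.card * P.card ≤ ∑ v ∈ P, (d v : ℝ) := by
    have : ∑ v ∈ P, (d v : ℝ) = ∑ x ∈ X, ((P.filter (E x)).card : ℝ) := by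
      have := sum_card_bipartiteAbove_eq_sum_card_bipartiteBelow (s := P) (t := X) (fun v x => E x v)
      simp only [bipartiteAbove, bipartiteBelow] at this
      exact_mod_cast this
    rw [this]
    calc _ = ∑ x ∈ X, δ * (P.card : ℝ) := by simp; ring
      _ ≤ _ := sum_le_sum hE
  set G := P.filter fun v => s ≤ d v with hG
  have h2 : ∑ v ∈ P, (d v : ℝ) ≤ s * P.card + X.card * G.card := by
    calc ∑ v ∈ P, (d v : ℝ) ≤ ∑ v ∈ P, ((s : ℝ) + if s ≤ d v then (X.card : ℝ) else 0) := by
          apply sum_le_sum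
          intro v _
          split_ifs with h
          · have : d v ≤ X.card := card_filter_le _ _
            have : (d v : ℝ) ≤ X.card := by exact_mod_cast this
            have : (0:ℝ) ≤ s := by positivity
            linarith
          · have : (d v : ℝ) ≤ s := by exact_mod_cast (by omega : d v ≤ s)
            linarith
      _ = _ := by
          rw [sum_add_distrib, ← sum_filter]; simp; ring
  have hXp : (0 : ℝ) < X.card := by exact_mod_cast hX0.card_pos
  have h3 : δ / 2 * P.card ≤ G.card := by
    have : X.card * (δ / 2 * P.card) ≤ X.card * (G.card : ℝ) := by
      have := mul_le_mul_of_nonneg_right hX (Nat.cast_nonneg (α := ℝ) P.card)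
      nlinarith
    exact le_of_mul_le_mul_left this hXp
  have h4 : G ⊆ (X.powersetCard s).biUnion fun J => P.filter fun v => ∀ x ∈ J, E x v := by
    intro v hv
    simp only [hG, mem_filter] at hv
    obtain ⟨J, hJ, hJc⟩ := exists_subset_card_eq hv.2
    simp only [mem_biUnion, mem_powersetCard, mem_filter]
    exact ⟨J, ⟨hJ.trans (filter_subset _ _), hJc⟩, hv.1, fun x hx => (mem_filter.mp (hJ hx)).2⟩
  have h5 : (G.card : ℝ) ≤ ∑ J ∈ X.powersetCard s, ((P.filter fun v => ∀ x ∈ J, E x v).card : ℝ) := by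
    exact_mod_cast (card_le_card h4).trans card_biUnion_le
  have h6 : (X.powersetCard s).Nonempty ∨ G.card = 0 := by
    by_contra h
    push Not at h
    obtain ⟨h, h'⟩ := h
    rw [h] at h4
    simp at h4
    simp [h4] at h'
  rcases h6 with h6 | h6
  · have h7 := h5.trans_lt (sum_lt_sum_of_nonempty h6 (fun J hJ => by
      rw [mem_powersetCard] at hJ; exact hcon J hJ.1 hJ.2))
    rw [sum_const, nsmul_eq_mul] at h7
    have h8 : ((X.powersetCard s).card : ℝ) ≤ 2 ^ X.card := by
      have : (X.powersetCard s).card ≤ 2 ^ X.card := by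
        rw [card_powersetCard]; exact Nat.choose_le_two_pow _ _
      exact_mod_cast this
    have h9 : ((X.powersetCard s).card : ℝ) * (δ / 2 / 2 ^ X.card * P.card) ≤ 
        2 ^ X.card * (δ / 2 / 2 ^ X.card * P.card) := by gcongr
    have h10 : (2:ℝ) ^ X.card * (δ / 2 / 2 ^ X.card * P.card) = δ / 2 * P.card := by
      field_simp
    linarith
  · rw [h6] at h3
    have hP : (P.card : ℝ) ≤ 0 := by
      push_cast at h3
      by_contra hh
      push Not at hh
      have := mul_pos (half_pos hδ) hh
      linarith
    have hP' : (0 : ℝ) < P.card := by exact_mod_cast hP0.card_pos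
    linarith

lemma avoid {ι κ : Type*} [Fintype ι] (F : ι → Finset ℕ) (hF : ∀ i, (F i).Nonempty)
    (C : Finset κ) (p q : κ → ι) (hpq : ∀ k ∈ C, p k ≠ q k) (B : κ → Finset (ℕ × ℕ)) (ε : ℝ)
    (hB : ∀ k ∈ C, ((B k).card : ℝ) ≤ ε * ((F (p k)).card * (F (q k)).card))
    (hε : C.card * ε < 1) :
    ∃ T : ι → ℕ, (∀ i, T i ∈ F i) ∧ ∀ k ∈ C, (T (p k), T (q k)) ∉ B k := by
  by_contra hcon
  push Not at hcon
  set W := Fintype.piFinset F with hW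
  have hWp : (0:ℝ) < W.card := by
    have : W.Nonempty := Fintype.piFinset_nonempty.mpr hF
    exact_mod_cast this.card_pos
  have h1 : W ⊆ C.biUnion fun k => W.filter fun T => (T (p k), T (q k)) ∈ B k := by
    intro T hT
    obtain ⟨k, hk, hk'⟩ := hcon T (Fintype.mem_piFinset.mp hT)
    simp only [mem_biUnion, mem_filter]
    exact ⟨k, hk, hT, hk'⟩
  have h2 : ∀ k ∈ C, ((W.filter fun T => (T (p k), T (q k)) ∈ B k).card : ℝ) ≤ ε * W.card := by
    intro k hk
    have hne := hpq k hk
    have hcard : ((W.filter fun T => (T (p k), T (q k)) ∈ B k) ×ˢ (F (p k) ×ˢ F (q k))).card ≤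
        (B k ×ˢ W).card := by
      apply card_le_card_of_injOn (fun z => ((z.1 (p k), z.1 (q k)),
        Function.update (Function.update z.1 (p k) z.2.1) (q k) z.2.2))
      · rintro ⟨T, u, v⟩ hz
        simp only [coe_product, Set.mem_prod, mem_coe, mem_filter] at hz
        obtain ⟨⟨hT, hb⟩, hu, hv⟩ := hz
        simp only [coe_product, Set.mem_prod, mem_coe]
        refine ⟨hb, ?_⟩
        rw [hW, Fintype.mem_piFinset] at hT ⊢
        intro i
        by_cases h : i = q k
        · subst h; simpa using hv
        · by_cases h' : i = p k
          · subst h'; simpa [Function.update_of_ne h] using hu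
          · simpa [Function.update_of_ne h, Function.update_of_ne h'] using hT i
      · rintro ⟨T, u, v⟩ _ ⟨T', u', v'⟩ _ h
        simp only [Prod.mk.injEq] at h
        obtain ⟨⟨ha, hb⟩, hc⟩ := h
        have hv : v = v' := by simpa using congrFun hc (q k)
        have hu : u = u' := by simpa [Function.update_of_ne hne] using congrFun hc (p k)
        have hT : T = T' := by
          funext i
          by_cases h : i = q k
          · subst h; exact hb
          · by_cases h' : i = p k
            · subst h'; exact ha
            · simpa [Function.update_of_ne h, Function.update_of_ne h'] using congrFun hc i
        simp [hv, hu, hT]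
    simp only [card_product] at hcard
    have hcard' : ((W.filter fun T => (T (p k), T (q k)) ∈ B k).card : ℝ) *
        ((F (p k)).card * (F (q k)).card) ≤ (B k).card * W.card := by exact_mod_cast hcard
    have hpos : (0:ℝ) < (F (p k)).card * (F (q k)).card := by
      have := (hF (p k)).card_pos
      have := (hF (q k)).card_pos
      positivity
    have := mul_le_mul_of_nonneg_right (hB k hk) hWp.le
    refine le_of_mul_le_mul_right ?_ hpos
    nlinarith
  have h3 : (W.card : ℝ) ≤ ∑ k ∈ C, ((W.filter fun T => (T (p k), T (q k)) ∈ B k).card : ℝ) := by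
    exact_mod_cast (card_le_card h1).trans card_biUnion_le
  have h4 := h3.trans (sum_le_sum h2)
  rw [sum_const, nsmul_eq_mul] at h4
  nlinarith

lemma heavy {α : Type*} (P : Finset α) (d : α → ℝ) (D δ : ℝ) (hD : 0 < D) (hδ : 0 < δ)
    (hd : ∀ v ∈ P, d v ≤ D) (h : δ * (P.card * D) ≤ ∑ v ∈ P, d v) :
    δ / 2 * P.card ≤ ((P.filter fun v => δ / 2 * D ≤ d v).card : ℝ) := by
  have h2 : ∑ v ∈ P, d v ≤ δ / 2 * D * P.card + D * (P.filter fun v => δ / 2 * D ≤ d v).card := by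
    calc ∑ v ∈ P, d v ≤ ∑ v ∈ P, (δ / 2 * D + if δ / 2 * D ≤ d v then D else 0) := by
          apply sum_le_sum
          intro v hv
          have : 0 < δ / 2 * D := by positivity
          split_ifs with h
          · linarith [hd v hv]
          · linarith
      _ = _ := by
          rw [sum_add_distrib, ← sum_filter]; simp; ring
  have : D * (δ / 2 * P.card) ≤ D * ((P.filter fun v => δ / 2 * D ≤ d v).card : ℝ) := by linarith
  exact le_of_mul_le_mul_left this hD

lemma rel_uniq (rel : ℕ → ℕ → ℕ → Prop)
    (hrel : (rel = fun _ b x => b < x) ∨ (rel = fun a b x => a < x ∧ x < b) ∨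
      (rel = fun a _ x => x < a)) (a b a' b' : ℕ) (hab : a < b) (hab' : a' < b')
    (ka : a' = a ∨ a' = b ∨ rel a b a') (kb : b' = a ∨ b' = b ∨ rel a b b')
    (ea : a ≠ a' → a ≠ b' → rel a' b' a) (eb : b ≠ a' → b ≠ b' → rel a' b' b) :
    a' = a ∧ b' = b := by
  rcases hrel with rfl | rfl | rfl <;> omega

lemma stage1 (m : ℕ) (δ : ℝ) (hδ : 0 < δ) (rel : ℕ → ℕ → ℕ → Prop)
    (hrel : (rel = fun _ b x => b < x) ∨ (rel = fun a b x => a < x ∧ x < b) ∨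
      (rel = fun a _ x => x < a)) :
    ∃ c : ℝ, 0 < c ∧ ∃ N : ℕ, ∀ (P : ℕ → ℕ → Finset ℕ) (I : Finset ℕ) (E : ℕ → ℕ → ℕ → ℕ → Prop),
      N ≤ I.card → (∀ a ∈ I, ∀ b ∈ I, a < b → (P a b).Nonempty) →
      (∀ a ∈ I, ∀ b ∈ I, ∀ x ∈ I, a < b → rel a b x →
        δ * ((P a b).card : ℝ) ≤ (((P a b).filter (E a b x)).card : ℝ)) →
      ∃ H ⊆ I, H.card = m ∧ ∀ a ∈ H, ∀ b ∈ H, a < b →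
        c * ((P a b).card : ℝ) ≤
          (((P a b).filter fun v => ∀ x ∈ H, rel a b x → E a b x v).card : ℝ) := by
  have hne : ∀ a b x, a < b → rel a b x → x ≠ a ∧ x ≠ b := by
    intro a b x hab h
    rcases hrel with rfl | rfl | rfl <;> omega
  obtain ⟨L0, hL0⟩ := exists_nat_ge (2 * m / δ)
  set L := max L0 2 with hL
  set t := max L m with ht
  obtain ⟨N, hN⟩ := ramsey_hyp (m + 2) ((t + 1) * (t + 1))
  refine ⟨δ / 2 / 2 ^ L, by positivity, N, ?_⟩
  intro P I E hI hP hE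
  obtain ⟨Y, hYI, hYc, hY⟩ := hN I hI (fun e => ∃ a ∈ e, ∃ b ∈ e, a < b ∧
    (∀ x ∈ e, x ≠ a → x ≠ b → rel a b x) ∧
    δ / 2 / 2 ^ L * ((P a b).card : ℝ) ≤
      (((P a b).filter fun v => ∀ x ∈ e, x ≠ a → x ≠ b → E a b x v).card : ℝ))
  obtain ⟨J, hJY, hJc, hJ⟩ := spaced t Y hYc
  have hcnt : ∀ a ∈ J, ∀ b ∈ J, a < b → t ≤ (Y.filter fun x => rel a b x).card := by
    intro a ha b hb hab
    obtain ⟨h1, h2, h3⟩ := hJ a ha b hb hab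
    rcases hrel with rfl | rfl | rfl
    · convert h3
    · convert h2
    · convert h1
  have hLt : L ≤ t := le_max_left _ _
  have hmt : m ≤ t := le_max_right _ _
  have h2L : 2 ≤ L := le_max_right _ _
  rcases hY with hY | hY
  · obtain ⟨H, hHJ, hHc⟩ := exists_subset_card_eq (hmt.trans hJc.ge)
    refine ⟨H, (hHJ.trans hJY).trans hYI, hHc, ?_⟩
    intro a ha b hb hab
    obtain ⟨K, hK1, hK2, hKc⟩ := exists_subsuperset_card_eq
      (s := H.filter fun x => rel a b x) (t := Y.filter fun x => rel a b x) (n := m)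
      (filter_subset_filter _ (hHJ.trans hJY)) ((card_filter_le _ _).trans hHc.le)
      (hmt.trans (hcnt a (hHJ ha) b (hHJ hb) hab))
    have hKr : ∀ x ∈ K, rel a b x := fun x hx => (mem_filter.mp (hK2 hx)).2
    have hbK : b ∉ K := fun h => (hne a b b hab (hKr b h)).2 rfl
    have haK : a ∉ insert b K := by
      intro h
      rcases mem_insert.mp h with h | h
      · omega
      · exact (hne a b a hab (hKr a h)).1 rfl
    obtain ⟨a', ha', b', hb', hab', hr', hc'⟩ := hY (insert a (insert b K)) (by
        intro x hx
        simp only [mem_insert] at hx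
        rcases hx with rfl | rfl | hx
        · exact hJY (hHJ ha)
        · exact hJY (hHJ hb)
        · exact (mem_filter.mp (hK2 hx)).1)
      (by rw [card_insert_of_notMem haK, card_insert_of_notMem hbK, hKc])
    have hEq : a' = a ∧ b' = b := by
      have ea := hr' a (by simp)
      have eb := hr' b (by simp)
      have ka : a' = a ∨ a' = b ∨ rel a b a' := by
        rcases mem_insert.mp ha' with h | h
        · exact Or.inl h
        · rcases mem_insert.mp h with h | h
          · exact Or.inr (Or.inl h)
          · exact Or.inr (Or.inr (hKr _ h))
      have kb : b' = a ∨ b' = b ∨ rel a b b' := by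
        rcases mem_insert.mp hb' with h | h
        · exact Or.inl h
        · rcases mem_insert.mp h with h | h
          · exact Or.inr (Or.inl h)
          · exact Or.inr (Or.inr (hKr _ h))
      exact rel_uniq rel hrel a b a' b' hab hab' ka kb ea eb
    obtain ⟨rfl, rfl⟩ := hEq
    refine hc'.trans ?_
    have : ((P a' b').filter fun v => ∀ x ∈ insert a' (insert b' K), x ≠ a' → x ≠ b' → E a' b' x v) ⊆
        ((P a' b').filter fun v => ∀ x ∈ H, rel a' b' x → E a' b' x v) := by
      intro v hv
      simp only [mem_filter] at hv ⊢
      refine ⟨hv.1, fun x hx hrx => ?_⟩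
      have hxK : x ∈ K := hK1 (mem_filter.mpr ⟨hx, hrx⟩)
      obtain ⟨n1, n2⟩ := hne _ _ _ hab hrx
      exact hv.2 x (by simp [hxK]) n1 n2
    exact_mod_cast card_le_card this
  · exfalso
    obtain ⟨a, ha, b, hb, hab⟩ : ∃ a ∈ J, ∃ b ∈ J, a < b := by
      obtain ⟨a, ha, b, hb, hab⟩ := one_lt_card.mp (by omega : 1 < J.card)
      rcases lt_or_gt_of_ne hab with h | h
      · exact ⟨a, ha, b, hb, h⟩
      · exact ⟨b, hb, a, ha, h⟩
    obtain ⟨X, hX, hXc⟩ := exists_subset_card_eq (hLt.trans (hcnt a ha b hb hab))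
    have haI := hYI (hJY ha)
    have hbI := hYI (hJY hb)
    obtain ⟨K, hKX, hKc, hK⟩ := popular (P a b) X (E a b) δ m hδ (by
        rw [hXc]
        have : (L0 : ℝ) ≤ L := by exact_mod_cast le_max_left _ _
        rw [div_le_iff₀ hδ] at hL0
        nlinarith)
      (fun x hx => by
        have hx' := mem_filter.mp (hX hx)
        exact hE a haI b hbI x (hYI hx'.1) hab hx'.2)
      (card_pos.mp (by omega)) (hP a haI b hbI hab)
    have hKr : ∀ x ∈ K, rel a b x := fun x hx => (mem_filter.mp (hX (hKX hx))).2
    have hbK : b ∉ K := fun h => (hne a b b hab (hKr b h)).2 rfl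
    have haK : a ∉ insert b K := by
      intro h
      rcases mem_insert.mp h with h | h
      · omega
      · exact (hne a b a hab (hKr a h)).1 rfl
    refine hY (insert a (insert b K)) ?_ ?_ ⟨a, by simp, b, by simp, hab, ?_, ?_⟩
    · intro x hx
      simp only [mem_insert] at hx
      rcases hx with rfl | rfl | hx
      · exact hJY ha
      · exact hJY hb
      · exact (mem_filter.mp (hX (hKX hx))).1
    · rw [card_insert_of_notMem haK, card_insert_of_notMem hbK, hKc]
    · intro x hx n1 n2
      simp only [mem_insert, n1, n2, false_or] at hx
      exact hKr x hx
    · rw [hXc] at hK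
      refine hK.trans ?_
      have : ((P a b).filter fun v => ∀ x ∈ K, E a b x v) ⊆
          ((P a b).filter fun v => ∀ x ∈ insert a (insert b K), x ≠ a → x ≠ b → E a b x v) := by
        intro v hv
        simp only [mem_filter] at hv ⊢
        refine ⟨hv.1, fun x hx n1 n2 => ?_⟩
        simp only [mem_insert, n1, n2, false_or] at hx
        exact hv.2 x hx
      exact_mod_cast card_le_card this

lemma stage2 (m : ℕ) (δ : ℝ) (hδ : 0 < δ) (rel : ℕ → ℕ → ℕ → Prop)
    (hrel : (rel = fun _ b x => b < x) ∨ (rel = fun a b x => a < x ∧ x < b) ∨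
      (rel = fun a _ x => x < a)) :
    ∃ μ' : ℝ, 0 < μ' ∧ ∃ N : ℕ, ∀ (P : ℕ → ℕ → Finset ℕ) (I : Finset ℕ)
      (E : ℕ → ℕ → ℕ → ℕ → Prop) (Lc Rc : ℕ → ℕ → ℕ → Finset (ℕ × ℕ)),
      (∀ a b, P a b = P b a) →
      N ≤ I.card → (∀ a ∈ I, ∀ b ∈ I, a < b → (P a b).Nonempty) →
      (∀ a ∈ I, ∀ b ∈ I, ∀ x ∈ I, a < b → rel a b x →
        δ * ((P a b).card : ℝ) ≤ (((P a b).filter (E a b x)).card : ℝ)) →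
      (∀ i ∈ I, ∀ j ∈ I, ∀ k ∈ I, i < j → j < k →
        ((Lc i j k).card : ℝ) ≤ μ' * ((P i j).card : ℝ) * ((P i k).card : ℝ) ∧
        ((Rc i j k).card : ℝ) ≤ μ' * ((P i k).card : ℝ) * ((P j k).card : ℝ)) →
      ∃ H ⊆ I, H.card = m ∧ ∃ T : ℕ → ℕ → ℕ,
        (∀ a ∈ H, ∀ b ∈ H, T a b = T b a) ∧ (∀ a ∈ H, ∀ b ∈ H, a ≠ b → T a b ∈ P a b) ∧
        (∀ a ∈ H, ∀ b ∈ H, ∀ x ∈ H, a < b → rel a b x → E a b x (T a b)) ∧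
        (∀ i ∈ H, ∀ j ∈ H, ∀ k ∈ H, i < j → j < k →
          (T i j, T i k) ∉ Lc i j k ∧ (T i k, T j k) ∉ Rc i j k) := by
  obtain ⟨c, hc, N, hN⟩ := stage1 m δ hδ rel hrel
  set M : ℝ := 2 * m ^ 3 + 1 with hM
  have hMp : 0 < M := by positivity
  refine ⟨c ^ 2 / M, by positivity, N, ?_⟩
  intro P I E Lc Rc hPs hI hP hE hch
  obtain ⟨H, hHI, hHc, hH⟩ := hN P I E hI hP hE
  refine ⟨H, hHI, hHc, ?_⟩
  -- avoidance
  let F : H × H → Finset ℕ := fun p => if p.1.1 < p.2.1 then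
    (P p.1 p.2).filter (fun v => ∀ x ∈ H, rel p.1 p.2 x → E p.1 p.2 x v) else {0}
  have hFl : ∀ a b : H, a.1 < b.1 → c * ((P a b).card : ℝ) ≤ ((F (a, b)).card : ℝ) := by
    intro a b hab
    simp only [F, if_pos hab]
    exact hH a a.2 b b.2 hab
  have hFn : ∀ p, (F p).Nonempty := by
    rintro ⟨a, b⟩
    by_cases hab : a.1 < b.1
    · have h1 := hFl a b hab
      have h2 : (0 : ℝ) < (P a b).card := by
        exact_mod_cast (hP a (hHI a.2) b (hHI b.2) hab).card_pos
      have h3 : (0 : ℝ) < (F (a, b)).card := lt_of_lt_of_le (mul_pos hc h2) h1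
      exact card_pos.mp (by exact_mod_cast h3)
    · simp only [F, if_neg hab]; exact singleton_nonempty 0
  let C : Finset (Bool × H × H × H) :=
    univ.filter fun z => z.2.1.1 < z.2.2.1.1 ∧ z.2.2.1.1 < z.2.2.2.1
  have hCc : (C.card : ℝ) ≤ 2 * m ^ 3 := by
    have : C.card ≤ 2 * m ^ 3 := by
      refine (card_filter_le _ _).trans ?_
      simp [hHc]
      apply le_of_eq; ring
    exact_mod_cast this
  have hgen : ∀ (A B : ℝ) (f g : ℝ), 0 ≤ A → 0 ≤ B → c * A ≤ f → c * B ≤ g →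
      c ^ 2 / M * A * B ≤ 1 / M * (f * g) := by
    intro A B f g hA hB hf hg
    have : (c * A) * (c * B) ≤ f * g := mul_le_mul hf hg (by positivity) (le_trans (by positivity) hf)
    calc c ^ 2 / M * A * B = 1 / M * ((c * A) * (c * B)) := by ring
      _ ≤ _ := by gcongr
  obtain ⟨T, hTF, hTC⟩ := avoid F hFn C
    (fun z => if z.1 then (z.2.1, z.2.2.1) else (z.2.1, z.2.2.2))
    (fun z => if z.1 then (z.2.1, z.2.2.2) else (z.2.2.1, z.2.2.2))
    (by
      rintro ⟨z, i, j, k⟩ hz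
      simp only [C, mem_filter, mem_univ, true_and] at hz
      have h1 : i ≠ j := fun h => by subst h; omega
      have h2 : j ≠ k := fun h => by subst h; omega
      cases z <;> simp [h1, h2])
    (fun z => if z.1 then Lc z.2.1 z.2.2.1 z.2.2.2 else Rc z.2.1 z.2.2.1 z.2.2.2) (1 / M)
    (by
      rintro ⟨z, i, j, k⟩ hz
      simp only [C, mem_filter, mem_univ, true_and] at hz
      obtain ⟨hij, hjk⟩ := hz
      obtain ⟨h1, h2⟩ := hch i (hHI i.2) j (hHI j.2) k (hHI k.2) hij hjk
      cases z
      · simpa using h2.trans (hgen _ _ _ _ (by positivity) (by positivity)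
          (hFl i k (hij.trans hjk)) (hFl j k hjk))
      · simpa using h1.trans (hgen _ _ _ _ (by positivity) (by positivity)
          (hFl i j hij) (hFl i k (hij.trans hjk))))
    (by
      rw [mul_one_div, div_lt_one hMp]; linarith)
  let T' : ℕ → ℕ → ℕ := fun a b => if h : min a b ∈ H ∧ max a b ∈ H then
    T (⟨min a b, h.1⟩, ⟨max a b, h.2⟩) else 0
  have hT' : ∀ a b : H, a.1 < b.1 → T' a b = T (a, b) := by
    intro a b hab
    simp only [T']
    have h1 : min a.1 b.1 = a.1 := min_eq_left hab.le
    have h2 : max a.1 b.1 = b.1 := max_eq_right hab.le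
    rw [dif_pos (by rw [h1, h2]; exact ⟨a.2, b.2⟩)]
    congr 2 <;> exact Subtype.ext (by assumption)
  have hTs : ∀ a b, T' a b = T' b a := by
    intro a b
    simp only [T', min_comm a b, max_comm a b]
  have hT'F : ∀ a ∈ H, ∀ b ∈ H, a < b → T' a b ∈ (P a b).filter
      (fun v => ∀ x ∈ H, rel a b x → E a b x v) := by
    intro a ha b hb hab
    have := hTF (⟨a, ha⟩, ⟨b, hb⟩)
    rw [← hT' ⟨a, ha⟩ ⟨b, hb⟩ hab] at this
    simpa only [F, if_pos hab] using this
  refine ⟨T', fun a _ b _ => hTs a b, ?_, ?_, ?_⟩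
  · intro a ha b hb hab
    rcases lt_or_gt_of_ne hab with h | h
    · exact (mem_filter.mp (hT'F a ha b hb h)).1
    · rw [hTs, hPs]
      exact (mem_filter.mp (hT'F b hb a ha h)).1
  · intro a ha b hb x hx hab hr
    exact (mem_filter.mp (hT'F a ha b hb hab)).2 x hx hr
  · intro i hi j hj k hk hij hjk
    have h1 := hTC (true, ⟨i, hi⟩, ⟨j, hj⟩, ⟨k, hk⟩) (by simp [C, hij, hjk])
    have h2 := hTC (false, ⟨i, hi⟩, ⟨j, hj⟩, ⟨k, hk⟩) (by simp [C, hij, hjk])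
    have e1 := hT' ⟨i, hi⟩ ⟨j, hj⟩ hij
    have e2 := hT' ⟨j, hj⟩ ⟨k, hk⟩ hjk
    have e3 := hT' ⟨i, hi⟩ ⟨k, hk⟩ (hij.trans hjk)
    simp only at e1 e2 e3
    rw [e1, e2, e3]
    exact ⟨by simpa using h1, by simpa using h2⟩

lemma card_prod_filter {α β : Type*} (X : Finset α) (Y : Finset β) (p : α × β → Prop) :
    ((X ×ˢ Y).filter p).card = ∑ x ∈ X, (Y.filter fun y => p (x, y)).card := by
  simp only [card_filter, sum_product]

lemma heavy_prod {α β : Type*} (X : Finset α) (Y : Finset β) (p : α × β → Prop) (δ : ℝ)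
    (hδ : 0 < δ) (hY : Y.Nonempty)
    (h : δ * (X.card * Y.card) ≤ (((X ×ˢ Y).filter p).card : ℝ)) :
    δ / 2 * X.card ≤ ((X.filter fun x =>
      δ / 2 * (Y.card : ℝ) ≤ ((Y.filter fun y => p (x, y)).card : ℝ)).card : ℝ) := by
  apply heavy X (fun x => ((Y.filter fun y => p (x, y)).card : ℝ)) Y.card δ
  · exact_mod_cast hY.card_pos
  · exact hδ
  · intro v _
    exact_mod_cast card_filter_le _ _
  · rw [card_prod_filter] at h
    exact_mod_cast h

/-- Lemma (`lem:inhabitedtransversals`): in a sufficiently large `(μ, vvv)`-dense reduced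
hypergraph, given small sets of forbidden left and right cherries, there is a set of `t`
indices carrying an inhabited triple of transversals avoiding all forbidden cherries. -/
theorem inhabited_transversals_avoiding_cherries :
    ∀ (t : ℕ) (μ : ℝ), 0 < μ → ∃ μ' : ℝ, 0 < μ' ∧ ∃ n₀ : ℕ,
      ∀ A : ReducedHG, n₀ ≤ A.I.card → A.VVVDense μ →
        ∀ Lc Rc : ℕ → ℕ → ℕ → Finset (ℕ × ℕ),
          (∀ i ∈ A.I, ∀ j ∈ A.I, ∀ k ∈ A.I, i < j → j < k →
            Lc i j k ⊆ A.P i j ×ˢ A.P i k ∧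
            ((Lc i j k).card : ℝ) ≤ μ' * ((A.P i j).card : ℝ) * ((A.P i k).card : ℝ) ∧
            Rc i j k ⊆ A.P i k ×ˢ A.P j k ∧
            ((Rc i j k).card : ℝ) ≤ μ' * ((A.P i k).card : ℝ) * ((A.P j k).card : ℝ)) →
          ∃ Is ⊆ A.I, Is.card = t ∧ ∃ Q R S : ℕ → ℕ → ℕ,
            A.IsTransversal Is Q ∧ A.IsTransversal Is R ∧ A.IsTransversal Is S ∧
            A.InhabitedTriple Is Q R S ∧
            (∀ i ∈ Is, ∀ j ∈ Is, ∀ k ∈ Is, i < j → j < k →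
              (Q i j, Q i k) ∉ Lc i j k ∧ (Q i k, Q j k) ∉ Rc i j k ∧
              (R i j, R i k) ∉ Lc i j k ∧ (R i k, R j k) ∉ Rc i j k ∧
              (S i j, S i k) ∉ Lc i j k ∧ (S i k, S j k) ∉ Rc i j k) := by
  intro t μ hμ
  obtain ⟨μ3, hμ3, N3, h3⟩ := stage2 t (μ / 2 / 2) (by positivity) _ (Or.inr (Or.inr rfl))
  obtain ⟨μ2, hμ2, N2, h2⟩ := stage2 N3 (μ / 2 / 2) (by positivity) _ (Or.inr (Or.inl rfl))
  obtain ⟨μ1, hμ1, N1, h1⟩ := stage2 N2 (μ / 2) (by positivity) _ (Or.inl rfl)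
  refine ⟨min μ1 (min μ2 μ3), by positivity, N1, ?_⟩
  intro A hI hA Lc Rc hch
  have hch' : ∀ ν : ℝ, min μ1 (min μ2 μ3) ≤ ν → ∀ i ∈ A.I, ∀ j ∈ A.I, ∀ k ∈ A.I, i < j → j < k →
      ((Lc i j k).card : ℝ) ≤ ν * ((A.P i j).card : ℝ) * ((A.P i k).card : ℝ) ∧
      ((Rc i j k).card : ℝ) ≤ ν * ((A.P i k).card : ℝ) * ((A.P j k).card : ℝ) := by
    intro ν hν i hi j hj k hk hij hjk
    obtain ⟨-, e1, -, e2⟩ := hch i hi j hj k hk hij hjk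
    exact ⟨e1.trans (by gcongr), e2.trans (by gcongr)⟩
  have hne : ∀ a ∈ A.I, ∀ b ∈ A.I, a < b → (A.P a b).Nonempty :=
    fun a ha b hb hab => A.Pnonempty a b ha hb hab.ne
  -- first stage
  obtain ⟨H1, hH1, hH1c, Q, hQs, hQP, hQE, hQc⟩ := h1 A.P A.I
    (fun i j k v => μ / 2 * (((A.P i k ×ˢ A.P j k).card : ℕ) : ℝ) ≤
      (((A.P i k ×ˢ A.P j k).filter fun y => A.Edge v y.1 y.2).card : ℝ)) Lc Rc A.Psymm hI hne
    (by
      intro i hi j hj k hk hij hjk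
      have hd := hA i j k hi hj hk hij.ne (hij.trans hjk).ne hjk.ne
      refine heavy_prod (A.P i j) (A.P i k ×ˢ A.P j k) (fun z => A.Edge z.1 z.2.1 z.2.2) μ hμ
        ((hne i hi k hk (hij.trans hjk)).product (hne j hj k hk hjk)) ?_
      unfold ReducedHG.ecount at hd
      rw [card_product]
      push_cast
      rw [← mul_assoc ((A.P i j).card : ℝ)]
      exact hd)
    (hch' μ1 (min_le_left _ _))
  -- second stage
  obtain ⟨H2, hH2, hH2c, R, hRs, hRP, hRE, hRc⟩ := h2 A.P H1
    (fun i k j u => μ / 2 / 2 * ((A.P j k).card : ℝ) ≤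
      (((A.P j k).filter fun w => A.Edge (Q i j) u w).card : ℝ)) Lc Rc A.Psymm hH1c.ge
    (fun a ha b hb => hne a (hH1 ha) b (hH1 hb))
    (by
      intro i hi k hk j hj hik hijk
      obtain ⟨hij, hjk⟩ := hijk
      have hd := hQE i hi j hj k hk hij hjk
      refine heavy_prod (A.P i k) (A.P j k) (fun z => A.Edge (Q i j) z.1 z.2) (μ / 2) (by positivity)
        (hne j (hH1 hj) k (hH1 hk) hjk) ?_
      rw [card_product] at hd
      push_cast at hd
      exact hd)
    (fun i hi j hj k hk => hch' μ2 ((min_le_right _ _).trans (min_le_left _ _))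
      i (hH1 hi) j (hH1 hj) k (hH1 hk))
  -- third stage
  obtain ⟨H3, hH3, hH3c, S, hSs, hSP, hSE, hSc⟩ := h3 A.P H2
    (fun j k i w => A.Edge (Q i j) (R i k) w) Lc Rc A.Psymm hH2c.ge
    (fun a ha b hb => hne a (hH1 (hH2 ha)) b (hH1 (hH2 hb)))
    (by
      intro j hj k hk i hi hjk hij
      exact hRE i hi k hk j hj (lt_trans hij hjk) ⟨hij, hjk⟩)
    (fun i hi j hj k hk => hch' μ3 ((min_le_right _ _).trans (min_le_right _ _))
      i (hH1 (hH2 hi)) j (hH1 (hH2 hj)) k (hH1 (hH2 hk)))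
  refine ⟨H3, (hH3.trans hH2).trans hH1, hH3c, Q, R, S, ⟨?_, ?_⟩, ⟨?_, ?_⟩, ⟨hSs, hSP⟩, ?_, ?_⟩
  · exact fun a ha b hb => hQs a (hH2 (hH3 ha)) b (hH2 (hH3 hb))
  · exact fun a ha b hb => hQP a (hH2 (hH3 ha)) b (hH2 (hH3 hb))
  · exact fun a ha b hb => hRs a (hH3 ha) b (hH3 hb)
  · exact fun a ha b hb => hRP a (hH3 ha) b (hH3 hb)
  · exact fun i hi j hj k hk hij hjk => hSE j hj k hk i hi hjk hij
  · intro i hi j hj k hk hij hjk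
    obtain ⟨q1, q2⟩ := hQc i (hH2 (hH3 hi)) j (hH2 (hH3 hj)) k (hH2 (hH3 hk)) hij hjk
    obtain ⟨r1, r2⟩ := hRc i (hH3 hi) j (hH3 hj) k (hH3 hk) hij hjk
    obtain ⟨s1, s2⟩ := hSc i hi j hj k hk hij hjk
    exact ⟨q1, q2, r1, r2, s1, s2⟩
end
end

section
/- For all t, r ∈ ℕ and μ > 0 there is s ∈ ℕ such that the following holds: let 𝒜 be a reduced hypergraph with index set I, let K, L ⊆ I be disjoint subsets each of size s, let X₁,…,X_r be sets of size s, and suppose that for every r-tuple x⃗ ∈ ∏_{i∈[r]} X_i, every k ∈ K and every ℓ ∈ L a subset 𝒫^{kℓ}_{x⃗} ⊆ 𝒫^{kℓ} of size at least μ|𝒫^{kℓ}| is given. Then there are subsets K' ⊆ K and L' ⊆ L of size t, subsets X'_i ⊆ X_i of size t for every i ∈ [r], and a (K',L')-transversal 𝒬 such that for every x⃗ ∈ ∏_{i∈[r]} X'_i and every (k,ℓ) ∈ K'×L' one has Q^{kℓ} ∈ 𝒫^{kℓ}_{x⃗}. -/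
open Finset Classical

noncomputable section

lemma core_degree {α : Type} (P : Finset α) (Y : Finset ℕ) (R : ℕ → Finset α) (t : ℕ) (μ : ℝ)
    (hY : 0 < Y.card) (ht : (t : ℝ) ≤ μ / 2 * Y.card)
    (hR : ∀ y ∈ Y, R y ⊆ P ∧ μ * (P.card : ℝ) ≤ ((R y).card : ℝ)) :
    μ / 2 * (P.card : ℝ) ≤ ((P.filter fun p => t ≤ (Y.filter fun y => p ∈ R y).card).card : ℝ) := by
  have h1 : (∑ y ∈ Y, (R y).card) = ∑ p ∈ P, (Y.filter fun y => p ∈ R y).card := by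
    have := Finset.sum_card_bipartiteAbove_eq_sum_card_bipartiteBelow (s := Y) (t := P)
      (fun y p => p ∈ R y)
    rw [← Finset.sum_congr rfl (fun p _ => rfl)] at this
    rw [← show ∑ p ∈ P, (Finset.bipartiteBelow (fun y p => p ∈ R y) Y p).card
      = ∑ p ∈ P, (Y.filter fun y => p ∈ R y).card from rfl, ← this]
    refine Finset.sum_congr rfl fun y hy => ?_
    congr 1
    ext p
    simp only [Finset.bipartiteAbove, Finset.mem_filter]
    exact ⟨fun h => ⟨(hR y hy).1 h, h⟩, fun h => h.2⟩
  have h2 : (Y.card : ℝ) * (μ * P.card) ≤ ((∑ y ∈ Y, (R y).card : ℕ) : ℝ) := by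
    push_cast
    rw [← nsmul_eq_mul]
    exact Finset.card_nsmul_le_sum _ _ _ fun y hy => (hR y hy).2
  have h3 : (∑ p ∈ P, (Y.filter fun y => p ∈ R y).card) ≤
      ∑ p ∈ P, ((if t ≤ (Y.filter fun y => p ∈ R y).card then 1 else 0) * Y.card + t) := by
    refine Finset.sum_le_sum fun p _ => ?_
    have := Finset.card_filter_le Y (fun y => p ∈ R y)
    split_ifs with h <;> omega
  rw [Finset.sum_add_distrib, ← Finset.sum_mul, ← Finset.card_filter, Finset.sum_const,
    smul_eq_mul] at h3
  rw [h1] at h2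
  set N := (P.filter fun p => t ≤ (Y.filter fun y => p ∈ R y).card).card with hN
  have h4 : (Y.card : ℝ) * (μ * P.card) ≤ (N : ℝ) * Y.card + P.card * t := by
    refine h2.trans ?_
    exact_mod_cast h3
  have hY' : (0 : ℝ) < Y.card := by exact_mod_cast hY
  have h5 : (P.card : ℝ) * t ≤ P.card * (μ / 2 * Y.card) :=
    mul_le_mul_of_nonneg_left ht (Nat.cast_nonneg _)
  refine le_of_mul_le_mul_right ?_ hY'
  linarith

lemma core (r : ℕ) : ∀ (t : ℕ) (μ : ℝ), 0 < μ → ∃ s : ℕ, ∀ (α : Type) (P : Finset α),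
    P.Nonempty → ∀ X : Fin r → Finset ℕ, (∀ i, s ≤ (X i).card) →
    ∀ S : (Fin r → ℕ) → Finset α,
      (∀ x : Fin r → ℕ, (∀ i, x i ∈ X i) → S x ⊆ P ∧ μ * (P.card : ℝ) ≤ ((S x).card : ℝ)) →
      ∃ X' : Fin r → Finset ℕ, (∀ i, X' i ⊆ X i ∧ (X' i).card = t) ∧
        ∃ q ∈ P, ∀ x : Fin r → ℕ, (∀ i, x i ∈ X' i) → q ∈ S x := by
  induction r with
  | zero =>
    intro t μ hμ
    refine ⟨0, fun α P hP X _ S hS => ?_⟩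
    obtain ⟨h1, h2⟩ := hS Fin.elim0 (fun i => i.elim0)
    have h3 : (0 : ℝ) < P.card := by exact_mod_cast hP.card_pos
    have h4 : 0 < (S Fin.elim0).card := by
      have : (0 : ℝ) < (S Fin.elim0).card := lt_of_lt_of_le (mul_pos hμ h3) h2
      exact_mod_cast this
    obtain ⟨q, hq⟩ := Finset.card_pos.mp h4
    refine ⟨X, fun i => i.elim0, q, h1 hq, fun x _ => ?_⟩
    rwa [Subsingleton.elim x Fin.elim0]
  | succ r ih =>
    intro t μ hμ
    obtain ⟨s1, hs1⟩ := exists_nat_ge (2 * t / μ + 1 + t)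
    have h0 : (0 : ℝ) ≤ t := Nat.cast_nonneg _
    have h0' : 0 ≤ 2 * (t : ℝ) / μ := by positivity
    have hts : t ≤ s1 := by
      have : (t : ℝ) ≤ s1 := by linarith
      exact_mod_cast this
    have hch : (0 : ℝ) < (s1.choose t : ℝ) := by exact_mod_cast Nat.choose_pos hts
    have hs1' : (0 : ℝ) < s1 := by
      have : 0 ≤ 2 * (t : ℝ) / μ := by positivity
      linarith
    have ht : (t : ℝ) ≤ μ / 2 * s1 := by
      have : 2 * (t : ℝ) / μ ≤ s1 := by linarith
      rw [div_le_iff₀ hμ] at this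
      linarith
    obtain ⟨s', hs'⟩ := ih t (μ / 2 / (s1.choose t : ℝ)) (by positivity)
    refine ⟨max s1 s', fun α P hP X hX S hS => ?_⟩
    obtain ⟨Y, hYX, hYc⟩ := Finset.exists_subset_card_eq ((le_max_left _ _).trans (hX 0))
    obtain ⟨X', hX', ⟨p, T⟩, hq, hq'⟩ := hs' (α × Finset ℕ) (P ×ˢ Y.powersetCard t)
      (hP.product (Finset.powersetCard_nonempty.mpr (hYc ▸ hts))) (fun i => X i.succ)
      (fun i => (le_max_right _ _).trans (hX i.succ))
      (fun x => (P ×ˢ Y.powersetCard t).filter fun z =>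
        ∀ y ∈ z.2, z.1 ∈ S (Fin.cons y x)) (by
        intro x hx
        refine ⟨Finset.filter_subset _ _, ?_⟩
        have hd := core_degree P Y (fun y => S (Fin.cons y x)) t μ
          (by rw [hYc]; exact_mod_cast hs1') (by rw [hYc]; exact ht) (by
            intro y hy
            refine hS _ fun i => ?_
            refine Fin.cases ?_ (fun j => ?_) i
            · simpa using hYX hy
            · simpa using hx j)
        rw [Finset.card_product, Finset.card_powersetCard, hYc]
        push_cast
        have e : μ / 2 / (s1.choose t : ℝ) * ((P.card : ℝ) * (s1.choose t : ℝ)) = μ / 2 * P.card := by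
          field_simp
        rw [e]
        refine hd.trans ?_
        norm_cast
        refine Finset.card_le_card_of_surjOn Prod.fst ?_
        intro p hp
        simp only [Finset.coe_filter, Set.mem_setOf_eq] at hp
        obtain ⟨T, hT, hTc⟩ := Finset.exists_subset_card_eq hp.2
        refine ⟨(p, T), ?_, rfl⟩
        simp only [Finset.coe_filter, Set.mem_setOf_eq, Finset.mem_product, Finset.mem_powersetCard]
        exact ⟨⟨hp.1, hT.trans (Finset.filter_subset _ _), hTc⟩,
          fun y hy => (Finset.mem_filter.mp (hT hy)).2⟩)
    have hpT := Finset.mem_product.mp hq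
    obtain ⟨hTY, hTc⟩ := Finset.mem_powersetCard.mp hpT.2
    refine ⟨Fin.cons T X', fun i => ?_, p, hpT.1, fun x hx => ?_⟩
    · refine Fin.cases ?_ (fun j => ?_) i
      · simpa using ⟨hTY.trans hYX, hTc⟩
      · simpa using hX' j
    · have h := hq' (Fin.tail x) (fun i => by simpa [Fin.tail] using hx i.succ)
      have := (Finset.mem_filter.mp h).2 (x 0) (by simpa using hx 0)
      simpa using this

/-- Lemma (`lem24cn`): given, for every tuple from a product of `r` sets, large subsets of
the classes `P k ℓ`, one can pass to subsets of size `t` and find one `(K',L')`-transversal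
that lies in all the prescribed subsets. -/
theorem common_transversal :
    ∀ (t r : ℕ) (μ : ℝ), 0 < μ → ∃ s : ℕ,
      ∀ (A : ReducedHG) (K L : Finset ℕ),
        K ⊆ A.I → L ⊆ A.I → Disjoint K L → K.card = s → L.card = s →
        ∀ X : Fin r → Finset ℕ, (∀ i, (X i).card = s) →
        ∀ Psub : (Fin r → ℕ) → ℕ → ℕ → Finset ℕ,
          (∀ x : Fin r → ℕ, (∀ i, x i ∈ X i) → ∀ k ∈ K, ∀ l ∈ L,
            Psub x k l ⊆ A.P k l ∧
            μ * ((A.P k l).card : ℝ) ≤ ((Psub x k l).card : ℝ)) →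
          ∃ (K' L' : Finset ℕ) (X' : Fin r → Finset ℕ) (Q : ℕ → ℕ → ℕ),
            K' ⊆ K ∧ L' ⊆ L ∧ K'.card = t ∧ L'.card = t ∧
            (∀ i, X' i ⊆ X i ∧ (X' i).card = t) ∧
            A.IsTransversal2 K' L' Q ∧
            (∀ x : Fin r → ℕ, (∀ i, x i ∈ X' i) → ∀ k ∈ K', ∀ l ∈ L',
              Q k l ∈ Psub x k l) := by
  intro t r μ hμ
  obtain ⟨s0, hs0⟩ := core r t (μ ^ (t * t)) (by positivity)
  refine ⟨max s0 t, fun A K L hKI hLI hKL hK hL X hX Psub hP => ?_⟩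
  obtain ⟨K', hK', hK'c⟩ := Finset.exists_subset_card_eq (hK ▸ le_max_right s0 t : t ≤ K.card)
  obtain ⟨L', hL', hL'c⟩ := Finset.exists_subset_card_eq (hL ▸ le_max_right s0 t : t ≤ L.card)
  have hmem : ∀ p : ↥(K' ×ˢ L'), p.1.1 ∈ K' ∧ p.1.2 ∈ L' := fun p => Finset.mem_product.mp p.2
  obtain ⟨X', hX', q, hq, hq'⟩ := hs0 (↥(K' ×ˢ L') → ℕ)
    (Fintype.piFinset fun p => A.P p.1.1 p.1.2)
    (by
      rw [Fintype.piFinset_nonempty]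
      intro p
      refine A.Pnonempty _ _ (hKI (hK' (hmem p).1)) (hLI (hL' (hmem p).2)) ?_
      exact fun h => Finset.disjoint_left.mp hKL (hK' (hmem p).1) (h ▸ hL' (hmem p).2))
    X (fun i => by rw [hX i]; exact le_max_left _ _)
    (fun x => Fintype.piFinset fun p => Psub x p.1.1 p.1.2)
    (by
      intro x hx
      refine ⟨Fintype.piFinset_subset _ _ fun p =>
        (hP x hx _ (hK' (hmem p).1) _ (hL' (hmem p).2)).1, ?_⟩
      rw [Fintype.card_piFinset, Fintype.card_piFinset]
      push_cast
      have hc : t * t = (Finset.univ : Finset ↥(K' ×ˢ L')).card := by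
        rw [Finset.card_univ, Fintype.card_coe, Finset.card_product, hK'c, hL'c]
      rw [hc, ← Finset.prod_const, ← Finset.prod_mul_distrib]
      refine Finset.prod_le_prod (fun p _ => by positivity) fun p _ => ?_
      exact (hP x hx _ (hK' (hmem p).1) _ (hL' (hmem p).2)).2)
  refine ⟨K', L', X', fun k l => if h : (k, l) ∈ K' ×ˢ L' then q ⟨(k, l), h⟩ else 0,
    hK', hL', hK'c, hL'c, hX', ?_, ?_⟩
  · intro k hk l hl
    have h : (k, l) ∈ K' ×ˢ L' := Finset.mk_mem_product hk hl
    simp only [h, dif_pos]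
    exact Fintype.mem_piFinset.mp hq ⟨(k, l), h⟩
  · intro x hx k hk l hl
    have h : (k, l) ∈ K' ×ˢ L' := Finset.mk_mem_product hk hl
    simp only [h, dif_pos]
    exact Fintype.mem_piFinset.mp (hq' x hx) ⟨(k, l), h⟩
end
end

section
/- For all t, r ∈ ℕ and μ > 0 there is s ∈ ℕ such that the following holds: let 𝒜 be a reduced hypergraph with index set I, let K, L, M ⊆ I be pairwise disjoint subsets each of size s, let X₁,…,X_r be sets of size s, and suppose that for every r-tuple x⃗ ∈ ∏_{i∈[r]} X_i a reduced subhypergraph 𝒜_{x⃗} ⊆ 𝒜 is given that is (μ,vvv)-tridense on K, L, M. Then there are subsets K⋆ ⊆ K, L⋆ ⊆ L, M⋆ ⊆ M of size t, subsets Y_i ⊆ X_i of size t for every i ∈ [r], and a triple consisting of a (K⋆,L⋆)-transversal 𝒬, a (K⋆,M⋆)-transversal ℛ and an (L⋆,M⋆)-transversal 𝒮 which is inhabited in 𝒜_{y⃗} for every y⃗ ∈ ∏_{i∈[r]} Y_i. -/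
open Finset Classical

noncomputable section

lemma cross_one (t : ℕ) (μ : ℝ) (hμ : 0 < μ) : ∃ (m : ℕ) (μ' : ℝ), 0 < μ' ∧
    ∀ {α : Type} (Ω : Finset α) (V : Finset ℕ) (B : ℕ → α → Prop), m ≤ V.card →
      (∀ x ∈ V, μ * (Ω.card : ℝ) ≤ ((Ω.filter fun ω => B x ω).card : ℝ)) →
      ∃ Y ⊆ V, Y.card = t ∧
        μ' * (Ω.card : ℝ) ≤ ((Ω.filter fun ω => ∀ y ∈ Y, B y ω).card : ℝ) := by
  obtain ⟨m0, hm0⟩ := exists_nat_ge (2 * (t : ℝ) / μ)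
  set m := m0 + t + 1 with hm
  have hm1 : 2 * (t : ℝ) ≤ μ * m := by
    rw [div_le_iff₀ hμ] at hm0
    have : (m : ℝ) = m0 + t + 1 := by rw [hm]; push_cast; ring
    rw [this]
    have : 0 ≤ μ * (t + 1) := by positivity
    nlinarith
  have hmpos : (0 : ℝ) < m := by rw [hm]; positivity
  refine ⟨m, μ / 2 / 2 ^ m, by positivity, ?_⟩
  intro α Ω V B hV hB
  obtain ⟨W, hWV, hWc⟩ := Finset.exists_subset_card_eq hV
  -- double counting
  have h1 : ∑ x ∈ W, ((Ω.filter fun ω => B x ω).card : ℝ)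
      = ∑ ω ∈ Ω, ((W.filter fun x => B x ω).card : ℝ) := by
    have := Finset.sum_card_bipartiteAbove_eq_sum_card_bipartiteBelow (s := W) (t := Ω)
      (fun x ω => B x ω)
    simp only [Finset.bipartiteAbove, Finset.bipartiteBelow] at this
    exact_mod_cast this
  have h2 : (m : ℝ) * (μ * Ω.card) ≤ ∑ x ∈ W, ((Ω.filter fun ω => B x ω).card : ℝ) := by
    have := Finset.card_nsmul_le_sum W (fun x => ((Ω.filter fun ω => B x ω).card : ℝ))
      (μ * Ω.card) (fun x hx => hB x (hWV hx))
    rwa [hWc, nsmul_eq_mul] at this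
  set G := Ω.filter fun ω => t ≤ (W.filter fun x => B x ω).card with hG
  have h3 : ∑ ω ∈ Ω, ((W.filter fun x => B x ω).card : ℝ) ≤ t * Ω.card + m * G.card := by
    have : ∀ ω ∈ Ω, ((W.filter fun x => B x ω).card : ℝ) ≤
        t + m * (if t ≤ (W.filter fun x => B x ω).card then (1 : ℝ) else 0) := by
      intro ω _
      split_ifs with h
      · have : (W.filter fun x => B x ω).card ≤ m := hWc ▸ Finset.card_filter_le _ _
        have : ((W.filter fun x => B x ω).card : ℝ) ≤ m := by exact_mod_cast this
        have : (0 : ℝ) ≤ t := by positivity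
        linarith
      · push Not at h
        have : ((W.filter fun x => B x ω).card : ℝ) ≤ t := by exact_mod_cast h.le
        linarith
    refine (Finset.sum_le_sum this).trans (le_of_eq ?_)
    rw [Finset.sum_add_distrib, ← Finset.mul_sum, Finset.sum_boole, Finset.sum_const, nsmul_eq_mul,
      mul_comm (t : ℝ)]
  have h4 : μ / 2 * Ω.card ≤ G.card := by
    have h5 : (m : ℝ) * (μ * Ω.card) ≤ t * Ω.card + m * G.card := by linarith
    have h6 : 2 * (t : ℝ) * Ω.card ≤ μ * m * Ω.card := by gcongr
    have : (m : ℝ) * (μ / 2 * Ω.card) ≤ m * G.card := by nlinarith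
    exact le_of_mul_le_mul_left this hmpos
  have h7 : G.card ≤ ∑ T ∈ W.powersetCard t, (Ω.filter fun ω => ∀ y ∈ T, B y ω).card := by
    refine le_trans (Finset.card_le_card ?_) Finset.card_biUnion_le
    intro ω hω
    rw [hG, Finset.mem_filter] at hω
    obtain ⟨T, hT, hTc⟩ := Finset.exists_subset_card_eq hω.2
    rw [Finset.mem_biUnion]
    refine ⟨T, Finset.mem_powersetCard.2 ⟨hT.trans (Finset.filter_subset _ _), hTc⟩, ?_⟩
    exact Finset.mem_filter.2 ⟨hω.1, fun y hy => (Finset.mem_filter.1 (hT hy)).2⟩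
  have hne : (W.powersetCard t).Nonempty := by
    rw [Finset.powersetCard_nonempty, hWc]; omega
  have hcard : ((W.powersetCard t).card : ℝ) ≤ 2 ^ m := by
    have : (W.powersetCard t).card ≤ 2 ^ m := by
      rw [Finset.card_powersetCard, hWc]; exact Nat.choose_le_two_pow _ _
    exact_mod_cast this
  obtain ⟨T, hT, hTle⟩ := Finset.exists_le_of_sum_le (f := fun _ => μ / 2 / 2 ^ m * (Ω.card : ℝ))
    (g := fun T => ((Ω.filter fun ω => ∀ y ∈ T, B y ω).card : ℝ)) hne (by
      rw [Finset.sum_const, nsmul_eq_mul]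
      have h8 : (G.card : ℝ) ≤ ∑ T ∈ W.powersetCard t,
        ((Ω.filter fun ω => ∀ y ∈ T, B y ω).card : ℝ) := by exact_mod_cast h7
      refine le_trans ?_ (h4.trans h8)
      calc ((W.powersetCard t).card : ℝ) * (μ / 2 / 2 ^ m * Ω.card)
          ≤ 2 ^ m * (μ / 2 / 2 ^ m * Ω.card) := by gcongr
        _ = μ / 2 * Ω.card := by field_simp)
  rw [Finset.mem_powersetCard] at hT
  exact ⟨T, hT.1.trans hWV, hT.2, hTle⟩

lemma cross_box (t n : ℕ) : ∀ (μ : ℝ), 0 < μ → ∃ (s : ℕ) (μ' : ℝ), 0 < μ' ∧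
    ∀ {α : Type} (Ω : Finset α) (V : Fin n → Finset ℕ) (B : (Fin n → ℕ) → α → Prop),
      (∀ i, s ≤ (V i).card) →
      (∀ x, (∀ i, x i ∈ V i) →
        μ * (Ω.card : ℝ) ≤ ((Ω.filter fun ω => B x ω).card : ℝ)) →
      ∃ Y : Fin n → Finset ℕ, (∀ i, Y i ⊆ V i ∧ (Y i).card = t) ∧
        μ' * (Ω.card : ℝ) ≤
          ((Ω.filter fun ω => ∀ y, (∀ i, y i ∈ Y i) → B y ω).card : ℝ) := by
  induction n with
  | zero =>
    intro μ hμ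
    refine ⟨0, μ, hμ, ?_⟩
    intro α Ω V B _ hB
    refine ⟨V, fun i => i.elim0, ?_⟩
    refine (hB (fun i => i.elim0) (fun i => i.elim0)).trans ?_
    have : (Ω.filter fun ω => B (fun i => i.elim0) ω) ⊆
        (Ω.filter fun ω => ∀ y, (∀ i, y i ∈ V i) → B y ω) := by
      intro ω hω
      rw [Finset.mem_filter] at hω ⊢
      refine ⟨hω.1, fun y _ => ?_⟩
      rw [Subsingleton.elim y (fun i => i.elim0)]
      exact hω.2
    have h := Finset.card_le_card this
    rw [Nat.cast_le]
    convert h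
  | succ n ih =>
    intro μ hμ
    obtain ⟨s1, μ1, hμ1, H1⟩ := ih μ hμ
    obtain ⟨m, μ2, hμ2, H2⟩ := cross_one t μ1 hμ1
    refine ⟨max s1 ((2 ^ s1) ^ n * (m + 1)), μ2, hμ2, ?_⟩
    intro α Ω V B hV hB
    have hsub : ∀ i : Fin n, ∃ W ⊆ V i.succ, W.card = s1 := fun i =>
      Finset.exists_subset_card_eq ((le_max_left _ _).trans (hV i.succ))
    choose W hWV hWc using hsub
    have hY : ∀ x0 : ℕ, ∃ Y : Fin n → Finset ℕ, x0 ∈ V 0 → ((∀ i, Y i ⊆ W i ∧ (Y i).card = t) ∧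
        μ1 * (Ω.card : ℝ) ≤
          ((Ω.filter fun ω => ∀ y, (∀ i, y i ∈ Y i) → B (Fin.cons x0 y) ω).card : ℝ)) := by
      intro x0
      by_cases hx : x0 ∈ V 0
      · obtain ⟨Y, hY⟩ := H1 Ω W (fun y => B (Fin.cons x0 y)) (fun i => (hWc i).ge) (by
          intro y hy
          apply hB
          intro i
          refine Fin.cases ?_ (fun j => ?_) i
          · simpa using hx
          · simpa using hWV j (hy j))
        exact ⟨Y, fun _ => hY⟩
      · exact ⟨W, fun h => absurd h hx⟩
    choose F hF using hY
    set C := Fintype.piFinset (fun i => (W i).powerset) with hC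
    have hCc : C.card = (2 ^ s1) ^ n := by
      rw [hC, Fintype.card_piFinset]
      simp [hWc]
    have hCne : C.Nonempty := by
      rw [← Finset.card_pos, hCc]; positivity
    obtain ⟨Z, hZ, hZc⟩ := Finset.exists_le_card_fiber_of_mul_le_card_of_maps_to
      (s := V 0) (t := C) (f := F) (n := m + 1) (by
        intro x hx
        rw [hC, Fintype.mem_piFinset]
        intro i
        exact Finset.mem_powerset.2 ((hF x hx).1 i).1) hCne (by
        rw [hCc]; exact (le_max_right _ _).trans (hV 0))
    set U := (V 0).filter fun x => F x = Z with hU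
    obtain ⟨Y0, hY0U, hY0c, hY0⟩ := H2 Ω U
      (fun x ω => ∀ y, (∀ i, y i ∈ Z i) → B (Fin.cons x y) ω) (by omega) (by
        intro x hx
        obtain ⟨hx0, rfl⟩ := Finset.mem_filter.1 hx
        exact (hF x hx0).2)
    refine ⟨Fin.cons Y0 Z, ?_, ?_⟩
    · have hUe : U.Nonempty := Finset.card_pos.1 (by omega)
      obtain ⟨x, hx⟩ := hUe
      obtain ⟨hx0, hxZ⟩ := Finset.mem_filter.1 hx
      intro i
      refine Fin.cases ?_ (fun j => ?_) i
      · exact ⟨hY0U.trans (Finset.filter_subset _ _), hY0c⟩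
      · rw [← hxZ]
        exact ⟨((hF x hx0).1 j).1.trans (hWV j), ((hF x hx0).1 j).2⟩
    · refine hY0.trans ?_
      have : (Ω.filter fun ω => ∀ x ∈ Y0, ∀ y, (∀ i, y i ∈ Z i) → B (Fin.cons x y) ω) ⊆
          (Ω.filter fun ω => ∀ y, (∀ i, y i ∈ (Fin.cons Y0 Z : Fin (n+1) → Finset ℕ) i) → B y ω) := by
        intro ω hω
        rw [Finset.mem_filter] at hω ⊢
        refine ⟨hω.1, fun y hy => ?_⟩
        have := hω.2 (y 0) (hy 0) (Fin.tail y) (fun i => hy i.succ)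
        rwa [Fin.cons_self_tail] at this
      exact_mod_cast Finset.card_le_card this

lemma cross_count {ι : Type} [Fintype ι] [DecidableEq ι] (P : ι → Finset ℕ) (a b c : ι)
    (hab : a ≠ b) (hac : a ≠ c) (hbc : b ≠ c) (H : ℕ → ℕ → ℕ → Prop) :
    ((Fintype.piFinset P).filter fun f => H (f a) (f b) (f c)).card *
      ((P a).card * (P b).card * (P c).card) =
    ((P a ×ˢ P b ×ˢ P c).filter fun tr => H tr.1 tr.2.1 tr.2.2).card *
      (Fintype.piFinset P).card := by
  set D := (Fintype.piFinset P).filter fun f => H (f a) (f b) (f c) with hD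
  set T := (P a ×ˢ P b ×ˢ P c).filter fun tr => H tr.1 tr.2.1 tr.2.2 with hT
  have hmap : ∀ f ∈ D, (f a, f b, f c) ∈ T := by
    intro f hf
    simp only [hD, hT, Finset.mem_filter, Fintype.mem_piFinset, Finset.mem_product] at hf ⊢
    exact ⟨⟨hf.1 a, hf.1 b, hf.1 c⟩, hf.2⟩
  rw [Finset.card_eq_sum_card_fiberwise hmap, Finset.sum_mul, Finset.card_eq_sum_ones T,
    Finset.sum_mul]
  refine Finset.sum_congr rfl ?_
  rintro ⟨u, v, w⟩ huvw
  simp only [hT, Finset.mem_filter, Finset.mem_product] at huvw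
  obtain ⟨⟨hu, hv, hw⟩, hH⟩ := huvw
  set P' : ι → Finset ℕ := fun i =>
    if i = a then {u} else if i = b then {v} else if i = c then {w} else P i with hP'
  have hfib : (D.filter fun f => (f a, f b, f c) = (u, v, w)) = Fintype.piFinset P' := by
    ext f
    simp only [hD, Finset.mem_filter, Fintype.mem_piFinset, Prod.mk.injEq, hP']
    constructor
    · rintro ⟨⟨h1, _⟩, rfl, rfl, rfl⟩ i
      split_ifs with h h h
      · simp [h]
      · simp [h]
      · simp [h]
      · exact h1 i
    · intro h
      have ha : f a = u := by simpa using h a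
      have hb : f b = v := by simpa [hab.symm] using h b
      have hc : f c = w := by simpa [hac.symm, hbc.symm] using h c
      refine ⟨⟨?_, by rwa [ha, hb, hc]⟩, ha, hb, hc⟩
      intro i
      have := h i
      split_ifs at this with h1 h1 h1
      · rw [h1, ha]; exact hu
      · rw [h1, hb]; exact hv
      · rw [h1, hc]; exact hw
      · exact this
  rw [hfib, Fintype.card_piFinset, Fintype.card_piFinset, one_mul,
    ← Finset.prod_mul_prod_compl {a, b, c} (fun i => (P' i).card),
    ← Finset.prod_mul_prod_compl {a, b, c} (fun i => (P i).card)]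
  have e1 : ∏ i ∈ ({a, b, c} : Finset ι), (P' i).card = 1 := by
    apply Finset.prod_eq_one
    intro i hi
    simp only [Finset.mem_insert, Finset.mem_singleton] at hi
    simp only [hP']
    split_ifs <;> simp_all
  have e2 : ∏ i ∈ ({a, b, c} : Finset ι)ᶜ, (P' i).card = ∏ i ∈ ({a, b, c} : Finset ι)ᶜ, (P i).card := by
    apply Finset.prod_congr rfl
    intro i hi
    simp only [Finset.mem_compl, Finset.mem_insert, Finset.mem_singleton, not_or] at hi
    simp [hP', hi.1, hi.2.1, hi.2.2]
  have e3 : ∏ i ∈ ({a, b, c} : Finset ι), (P i).card = (P a).card * (P b).card * (P c).card := by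
    rw [Finset.prod_insert (by simp [hab, hac]), Finset.prod_pair hbc, mul_assoc]
  rw [e1, e2, e3]; ring

set_option maxHeartbeats 2000000 in
/-- Lemma (`lem:crossinhabited`): given `(μ, vvv)`-tridense reduced subhypergraphs `𝒜_x⃗`
of `𝒜` on `K, L, M`, one for each tuple `x⃗` from a product of `r` sets, there are subsets
of size `t` and a triple of transversals inhabited in every `𝒜_y⃗`. -/
theorem cross_inhabited :
    ∀ (t r : ℕ) (μ : ℝ), 0 < μ → ∃ s : ℕ,
      ∀ (A : ReducedHG) (K L M : Finset ℕ),
        K ⊆ A.I → L ⊆ A.I → M ⊆ A.I →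
        Disjoint K L → Disjoint K M → Disjoint L M →
        K.card = s → L.card = s → M.card = s →
        ∀ X : Fin r → Finset ℕ, (∀ i, (X i).card = s) →
        ∀ E' : (Fin r → ℕ) → ℕ → ℕ → ℕ → Prop,
          (∀ x : Fin r → ℕ, (∀ i, x i ∈ X i) →
            ∀ a b c, E' x a b c → A.Edge a b c) →
          (∀ x : Fin r → ℕ, (∀ i, x i ∈ X i) → ∀ k ∈ K, ∀ l ∈ L, ∀ m ∈ M,
            μ * (((A.P k l).card : ℝ) * ((A.P k m).card : ℝ) * ((A.P l m).card : ℝ)) ≤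
              ((((A.P k l ×ˢ A.P k m ×ˢ A.P l m).filter
                fun tr => E' x tr.1 tr.2.1 tr.2.2).card : ℝ))) →
          ∃ (Ks Ls Ms : Finset ℕ) (Y : Fin r → Finset ℕ) (Q R S : ℕ → ℕ → ℕ),
            Ks ⊆ K ∧ Ls ⊆ L ∧ Ms ⊆ M ∧
            Ks.card = t ∧ Ls.card = t ∧ Ms.card = t ∧
            (∀ i, Y i ⊆ X i ∧ (Y i).card = t) ∧
            A.IsTransversal2 Ks Ls Q ∧ A.IsTransversal2 Ks Ms R ∧
            A.IsTransversal2 Ls Ms S ∧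
            (∀ y : Fin r → ℕ, (∀ i, y i ∈ Y i) →
              ∀ k ∈ Ks, ∀ l ∈ Ls, ∀ m ∈ Ms, E' y (Q k l) (R k m) (S l m)) := by
  intro t r μ hμ
  obtain ⟨s, μ', hμ', Hbox⟩ := cross_box t (r + 3) μ hμ
  refine ⟨s, ?_⟩
  intro A K L M hK hL hM hKL hKM hLM hKc hLc hMc X hX E' _ hE
  set D : Finset (ℕ × ℕ) := K ×ˢ L ∪ K ×ˢ M ∪ L ×ˢ M with hD
  have hDP : ∀ p ∈ D, (A.P p.1 p.2).Nonempty := by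
    intro p hp
    simp only [hD, Finset.mem_union, Finset.mem_product] at hp
    rcases hp with (⟨h1, h2⟩ | ⟨h1, h2⟩) | ⟨h1, h2⟩
    · exact A.Pnonempty _ _ (hK h1) (hL h2) (fun h => Finset.disjoint_left.1 hKL h1 (h ▸ h2))
    · exact A.Pnonempty _ _ (hK h1) (hM h2) (fun h => Finset.disjoint_left.1 hKM h1 (h ▸ h2))
    · exact A.Pnonempty _ _ (hL h1) (hM h2) (fun h => Finset.disjoint_left.1 hLM h1 (h ▸ h2))
  have hDKL : ∀ k ∈ K, ∀ l ∈ L, (k, l) ∈ D := by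
    intro k hk l hl; simp [hD, hk, hl]
  have hDKM : ∀ k ∈ K, ∀ l ∈ M, (k, l) ∈ D := by
    intro k hk l hl; simp [hD, hk, hl]
  have hDLM : ∀ k ∈ L, ∀ l ∈ M, (k, l) ∈ D := by
    intro k hk l hl; simp [hD, hk, hl]
  set PP : D → Finset ℕ := fun p => A.P p.1.1 p.1.2 with hPP
  set Ω := Fintype.piFinset PP with hΩ
  have hΩne : Ω.Nonempty := Fintype.piFinset_nonempty.2 (fun p => hDP p.1 p.2)
  set ext : (D → ℕ) → ℕ → ℕ → ℕ := fun f i j => if h : (i, j) ∈ D then f ⟨(i, j), h⟩ else 0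
    with hext
  have hextP : ∀ f ∈ Ω, ∀ i j, (i, j) ∈ D → ext f i j ∈ A.P i j := by
    intro f hf i j h
    simp only [hext, dif_pos h]
    exact Fintype.mem_piFinset.1 hf ⟨(i, j), h⟩
  set V : Fin (r + 3) → Finset ℕ := Fin.cons K (Fin.cons L (Fin.cons M X)) with hV
  set B : (Fin (r + 3) → ℕ) → (D → ℕ) → Prop := fun x f =>
    E' (fun i => x i.succ.succ.succ) (ext f (x 0) (x 1)) (ext f (x 0) (x 2)) (ext f (x 1) (x 2))
    with hB
  obtain ⟨Y, hY, hYd⟩ := Hbox Ω V B (by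
      intro i
      refine Fin.cases hKc.ge (fun i => ?_) i
      refine Fin.cases hLc.ge (fun i => ?_) i
      refine Fin.cases hMc.ge (fun i => ?_) i
      exact (hX i).ge) (by
      intro x hx
      have hk : x 0 ∈ K := hx 0
      have hl : x 1 ∈ L := hx 1
      have hm : x 2 ∈ M := hx 2
      have hxX : ∀ i : Fin r, x i.succ.succ.succ ∈ X i := fun i => hx i.succ.succ.succ
      have d1 := hDKL _ hk _ hl
      have d2 := hDKM _ hk _ hm
      have d3 := hDLM _ hl _ hm
      have hc := cross_count PP ⟨_, d1⟩ ⟨_, d2⟩ ⟨_, d3⟩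
        (by
          intro h
          have h' : x 1 = x 2 := congrArg (fun p => p.1.2) h
          exact Finset.disjoint_left.1 hLM hl (h' ▸ hm))
        (by
          intro h
          have h' : x 1 = x 2 := congrArg (fun p => p.1.2) h
          exact Finset.disjoint_left.1 hLM hl (h' ▸ hm))
        (by
          intro h
          have h' : x 0 = x 1 := congrArg (fun p => p.1.1) h
          exact Finset.disjoint_left.1 hKL hk (h' ▸ hl))
        (E' (fun i => x i.succ.succ.succ))
      have he := hE (fun i => x i.succ.succ.succ) hxX _ hk _ hl _ hm
      have hBeq : (Ω.filter fun ω => B x ω) = (Ω.filter fun f => E' (fun i => x i.succ.succ.succ)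
          (f ⟨_, d1⟩) (f ⟨_, d2⟩) (f ⟨_, d3⟩)) := by
        simp only [hB, hext, dif_pos d1, dif_pos d2, dif_pos d3]
      rw [hBeq]
      have p1 : (0 : ℝ) < (A.P (x 0) (x 1)).card := by exact_mod_cast (hDP _ d1).card_pos
      have p2 : (0 : ℝ) < (A.P (x 0) (x 2)).card := by exact_mod_cast (hDP _ d2).card_pos
      have p3 : (0 : ℝ) < (A.P (x 1) (x 2)).card := by exact_mod_cast (hDP _ d3).card_pos
      have hc' := congrArg (fun n : ℕ => (n : ℝ)) hc
      simp only [Nat.cast_mul, hPP] at hc'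
      refine le_of_mul_le_mul_right ?_ (mul_pos (mul_pos p1 p2) p3)
      refine le_trans ?_ hc'.ge
      calc _ = (μ * (((A.P (x 0) (x 1)).card : ℝ) * ((A.P (x 0) (x 2)).card : ℝ) *
            ((A.P (x 1) (x 2)).card : ℝ))) * (Ω.card : ℝ) := by ring
        _ ≤ _ := mul_le_mul_of_nonneg_right he (Nat.cast_nonneg _))
  have hpos : (0 : ℝ) < ((Ω.filter fun ω => ∀ y, (∀ i, y i ∈ Y i) → B y ω).card : ℝ) :=
    lt_of_lt_of_le (mul_pos hμ' (by exact_mod_cast hΩne.card_pos)) hYd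
  obtain ⟨f, hf⟩ := Finset.card_pos.1 (by exact_mod_cast hpos)
  obtain ⟨hfΩ, hfB⟩ := Finset.mem_filter.1 hf
  have y0 : Y 0 ⊆ K := (hY 0).1
  have y1 : Y 1 ⊆ L := (hY 1).1
  have y2 : Y 2 ⊆ M := (hY 2).1
  refine ⟨Y 0, Y 1, Y 2, fun i => Y i.succ.succ.succ, ext f, ext f, ext f, y0, y1, y2,
    (hY 0).2, (hY 1).2, (hY 2).2, fun i => hY i.succ.succ.succ, ?_, ?_, ?_, ?_⟩
  · exact fun k hk l hl => hextP f hfΩ k l (hDKL _ (y0 hk) _ (y1 hl))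
  · exact fun k hk l hl => hextP f hfΩ k l (hDKM _ (y0 hk) _ (y2 hl))
  · exact fun k hk l hl => hextP f hfΩ k l (hDLM _ (y1 hk) _ (y2 hl))
  · intro y hy k hk l hl m hm
    have := hfB (Fin.cons k (Fin.cons l (Fin.cons m y))) (by
      intro i
      refine Fin.cases hk (fun i => ?_) i
      refine Fin.cases hl (fun i => ?_) i
      refine Fin.cases hm (fun i => ?_) i
      exact hy i)
    exact this
end
end

section
/- Let t ∈ ℕ and μ, d > 0. There exists s ∈ ℕ such that the following holds: if 𝒜 is a (d,ee)-dense reduced hypergraph with index set I that does not support a K₅⁽³⁾, K, L ⊆ I are disjoint subsets each of size at least s, and 𝒬 is a (K,L)-transversal, then there exist K⋆ ⊆ K and L⋆ ⊆ L of size t such that for every ℓ ∈ L⋆ the link Λ(𝒬, K⋆, ℓ) is a (μ,d)-hole on K⋆. -/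
open Finset Classical

noncomputable section

namespace ReducedHG

lemma supportsK5_of (A : ReducedHG) (g : Fin 5 → ℕ) (hg : Function.Injective g)
    (hI : ∀ a, g a ∈ A.I) (f : Fin 5 → Fin 5 → ℕ) (hs : ∀ a b, f a b = f b a)
    (hP : ∀ a b, a < b → f a b ∈ A.P (g a) (g b))
    (hE : ∀ a b c, a < b → b < c → A.Edge (f a b) (f a c) (f b c)) : A.SupportsK5 := by
  have hP' : ∀ a b, a ≠ b → f a b ∈ A.P (g a) (g b) := by
    intro a b hab
    rcases lt_or_gt_of_ne hab with h | h
    · exact hP a b h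
    · rw [hs, A.Psymm]; exact hP b a h
  have hE' : ∀ a b c, a ≠ b → a ≠ c → b ≠ c → A.Edge (f a b) (f a c) (f b c) := by
    have s1 := A.EdgeSymm
    have s2 := A.EdgeSymm'
    intro a b c hab hac hbc
    rcases lt_or_gt_of_ne hab with h1 | h1 <;> rcases lt_or_gt_of_ne hac with h2 | h2 <;>
      rcases lt_or_gt_of_ne hbc with h3 | h3
    · exact hE a b c h1 h3
    · have := hE a c b h2 h3
      rw [hs c b] at this
      exact s1 _ _ _ this
    · exact absurd (h1.trans h3) (not_lt.2 h2.le)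
    · have := hE c a b h2 h1
      rw [hs c a, hs c b] at this
      exact s1 _ _ _ (s2 _ _ _ this)
    · have := hE b a c h1 h2
      rw [hs b a] at this
      exact s2 _ _ _ this
    · exact absurd (h1.trans h2) (not_lt.2 h3.le)
    · have := hE b c a h3 h2
      rw [hs b a, hs c a] at this
      exact s2 _ _ _ (s1 _ _ _ this)
    · have := hE c b a h3 h1
      rw [hs c b, hs c a, hs b a] at this
      exact s1 _ _ _ (s2 _ _ _ (s1 _ _ _ this))
  have hinv : ∀ a, Function.invFun g (g a) = a := Function.leftInverse_invFun hg
  refine ⟨Finset.univ.image g, ?_, ?_, fun i j => f (Function.invFun g i) (Function.invFun g j),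
    ?_, ?_, ?_⟩
  · intro x hx
    obtain ⟨a, -, rfl⟩ := Finset.mem_image.1 hx
    exact hI a
  · rw [Finset.card_image_of_injective _ hg]; simp
  · intro i _ j _; exact hs _ _
  · intro i hi j hj hij
    obtain ⟨a, -, rfl⟩ := Finset.mem_image.1 hi
    obtain ⟨b, -, rfl⟩ := Finset.mem_image.1 hj
    simp only [hinv]
    exact hP' a b (fun h => hij (by rw [h]))
  · intro i hi j hj k hk hij hik hjk
    obtain ⟨a, -, rfl⟩ := Finset.mem_image.1 hi
    obtain ⟨b, -, rfl⟩ := Finset.mem_image.1 hj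
    obtain ⟨c, -, rfl⟩ := Finset.mem_image.1 hk
    simp only [hinv]
    exact hE' a b c (fun h => hij (by rw [h])) (fun h => hik (by rw [h])) (fun h => hjk (by rw [h]))

lemma k5_explicit (A : ReducedHG) (k1 k2 k3 l m : ℕ) (x y z v : ℕ) (Q : ℕ → ℕ → ℕ)
    (hk1 : k1 ∈ A.I) (hk2 : k2 ∈ A.I) (hk3 : k3 ∈ A.I) (hl : l ∈ A.I) (hm : m ∈ A.I)
    (h12 : k1 ≠ k2) (h13 : k1 ≠ k3) (h23 : k2 ≠ k3) (hlm : l ≠ m)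
    (h1l : k1 ≠ l) (h2l : k2 ≠ l) (h3l : k3 ≠ l) (h1m : k1 ≠ m) (h2m : k2 ≠ m) (h3m : k3 ≠ m)
    (hx : x ∈ A.P k1 k2) (hy : y ∈ A.P k1 k3) (hz : z ∈ A.P k2 k3) (hv : v ∈ A.P l m)
    (q1l : Q k1 l ∈ A.P k1 l) (q2l : Q k2 l ∈ A.P k2 l) (q3l : Q k3 l ∈ A.P k3 l)
    (q1m : Q k1 m ∈ A.P k1 m) (q2m : Q k2 m ∈ A.P k2 m) (q3m : Q k3 m ∈ A.P k3 m)
    (e : A.Edge x y z)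
    (e1 : A.Edge (Q k1 l) (Q k2 l) x) (e2 : A.Edge (Q k1 l) (Q k3 l) y)
    (e3 : A.Edge (Q k2 l) (Q k3 l) z)
    (e1' : A.Edge (Q k1 m) (Q k2 m) x) (e2' : A.Edge (Q k1 m) (Q k3 m) y)
    (e3' : A.Edge (Q k2 m) (Q k3 m) z)
    (f1 : A.Edge (Q k1 l) (Q k1 m) v) (f2 : A.Edge (Q k2 l) (Q k2 m) v)
    (f3 : A.Edge (Q k3 l) (Q k3 m) v) : A.SupportsK5 := by
  have rot : ∀ a b c, A.Edge a b c → A.Edge c a b := fun a b c h =>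
    A.EdgeSymm _ _ _ (A.EdgeSymm' _ _ _ h)
  refine supportsK5_of A ![k1, k2, k3, l, m] ?_ ?_
    ![![0, x, y, Q k1 l, Q k1 m], ![x, 0, z, Q k2 l, Q k2 m], ![y, z, 0, Q k3 l, Q k3 m],
      ![Q k1 l, Q k2 l, Q k3 l, 0, v], ![Q k1 m, Q k2 m, Q k3 m, v, 0]] ?_ ?_ ?_
  · intro a b hab
    fin_cases a <;> fin_cases b <;> simp_all
  · intro a
    fin_cases a <;> simpa
  · intro a b
    fin_cases a <;> fin_cases b <;> rfl
  · intro a b hab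
    fin_cases a <;> fin_cases b <;> first | (exact absurd hab (by decide)) | assumption
  · intro a b c hab hbc
    fin_cases a <;> fin_cases b <;> first
      | (exact absurd hab (by decide))
      | (fin_cases c <;> first
          | (exact absurd hbc (by decide))
          | assumption
          | (apply rot; assumption))

/-- shrink -/
lemma shrink (A : ReducedHG) {d : ℝ} (hd : 0 < d) (hA : A.EEDense d) (K L : Finset ℕ)
    (hK : K ⊆ A.I) (hL : L ⊆ A.I) (hKL : Disjoint K L) (Q : ℕ → ℕ → ℕ)
    (hQ : A.IsTransversal2 K L Q) (S : Finset (ℕ × ℕ)) (hS : S ⊆ L.offDiag) :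
    ∃ K' ⊆ K, d ^ S.card * (K.card : ℝ) ≤ K'.card ∧
      ∀ p ∈ S, ∃ v ∈ A.P p.1 p.2, ∀ k ∈ K', A.Edge (Q k p.1) (Q k p.2) v := by
  induction S using Finset.induction_on with
  | empty => exact ⟨K, Subset.rfl, by simp, by simp⟩
  | insert p S hp ih =>
    obtain ⟨K', hK', hc, hv⟩ := ih (fun q hq => hS (mem_insert_of_mem hq))
    have hpL := hS (mem_insert_self p S)
    obtain ⟨l, m⟩ := p
    simp only [mem_offDiag] at hpL
    obtain ⟨hl, hm, hlm⟩ := hpL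
    have hne := A.Pnonempty l m (hL hl) (hL hm) hlm
    have key : ∃ v ∈ A.P l m,
        d * (K'.card : ℝ) ≤ ((K'.filter fun k => A.Edge (Q k l) (Q k m) v).card : ℝ) := by
      apply Finset.exists_le_of_sum_le hne
      have h1 : (∑ v ∈ A.P l m, ((K'.filter fun k => A.Edge (Q k l) (Q k m) v).card : ℝ))
          = ∑ k ∈ K', ((A.nbhd l m (Q k l) (Q k m)).card : ℝ) := by
        have := Finset.sum_card_bipartiteAbove_eq_sum_card_bipartiteBelow
          (s := K') (t := A.P l m) (fun k v => A.Edge (Q k l) (Q k m) v)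
        unfold Finset.bipartiteAbove Finset.bipartiteBelow at this
        unfold nbhd
        exact_mod_cast this.symm
      rw [h1]
      calc ∑ v ∈ A.P l m, d * (K'.card : ℝ) = ∑ k ∈ K', d * ((A.P l m).card : ℝ) := by
            simp; ring
        _ ≤ _ := by
            apply Finset.sum_le_sum
            intro k hk
            have hkK := hK' hk
            exact hA k l m (hK hkK) (hL hl) (hL hm)
              (fun h => Finset.disjoint_left.1 hKL hkK (h ▸ hl))
              (fun h => Finset.disjoint_left.1 hKL hkK (h ▸ hm)) hlm _ (hQ k hkK l hl) _
              (hQ k hkK m hm)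
    obtain ⟨v, hvP, hvc⟩ := key
    refine ⟨_, (filter_subset _ _).trans hK', le_trans ?_ hvc, ?_⟩
    · rw [card_insert_of_notMem hp, pow_succ]
      calc d ^ S.card * d * (K.card : ℝ) = d * (d ^ S.card * K.card) := by ring
        _ ≤ _ := by gcongr
    · intro q hq
      rcases mem_insert.1 hq with rfl | hq
      · exact ⟨v, hvP, fun k hk => (mem_filter.1 hk).2⟩
      · obtain ⟨w, hw, hw'⟩ := hv q hq
        exact ⟨w, hw, fun k hk => hw' k (mem_filter.1 hk).1⟩

lemma link_inter (A : ReducedHG) (K : Finset ℕ) (f : ℕ → ℕ) (i j : ℕ) (hi : i ∈ K) (hj : j ∈ K)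
    (hij : i ≠ j) : A.link K f ∩ A.P i j = A.nbhd i j (f i) (f j) := by
  ext c
  simp only [link, nbhd, mem_inter, mem_biUnion, mem_filter, mem_product]
  constructor
  · rintro ⟨⟨⟨p, q⟩, ⟨⟨hp, hq⟩, hpq⟩, hc, he⟩, hc'⟩
    refine ⟨hc', ?_⟩
    by_cases h : ({p, q} : Finset ℕ) = {i, j}
    · have h1 : p ∈ ({i, j} : Finset ℕ) := h ▸ (by simp)
      have h2 : q ∈ ({i, j} : Finset ℕ) := h ▸ (by simp)
      simp only [mem_insert, mem_singleton] at h1 h2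
      simp only at hpq he
      rcases h1 with rfl | rfl <;> rcases h2 with rfl | rfl
      · exact absurd rfl hpq
      · exact he
      · exact A.EdgeSymm _ _ _ he
      · exact absurd rfl hpq
    · exact absurd hc' (Finset.disjoint_left.1 (A.Pdisjoint p q i j hpq hij h) hc)
  · rintro ⟨hc, he⟩
    exact ⟨⟨(i, j), ⟨⟨hi, hj⟩, hij⟩, hc, he⟩, hc⟩

/-- badness of `l` for a triple -/
def badL (A : ReducedHG) (μ : ℝ) (Q : ℕ → ℕ → ℕ) (L : Finset ℕ) (t : ℕ × ℕ × ℕ) : Finset ℕ :=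
  L.filter fun l => μ * (((A.P t.1 t.2.1).card : ℝ) * ((A.P t.1 t.2.2).card : ℝ) *
      ((A.P t.2.1 t.2.2).card : ℝ)) <
    (A.ecount (A.nbhd t.1 t.2.1 (Q t.1 l) (Q t.2.1 l)) (A.nbhd t.1 t.2.2 (Q t.1 l) (Q t.2.2 l))
      (A.nbhd t.2.1 t.2.2 (Q t.2.1 l) (Q t.2.2 l)) : ℝ)

lemma badL_card (A : ReducedHG) (hA : ¬ A.SupportsK5) {μ : ℝ} (hμ : 0 < μ) (K L : Finset ℕ)
    (hK : K ⊆ A.I) (hL : L ⊆ A.I) (hKL : Disjoint K L) (Q : ℕ → ℕ → ℕ)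
    (hQ : A.IsTransversal2 K L Q)
    (hv : ∀ p ∈ L.offDiag, ∃ v ∈ A.P p.1 p.2, ∀ k ∈ K, A.Edge (Q k p.1) (Q k p.2) v)
    (i j k : ℕ) (hi : i ∈ K) (hj : j ∈ K) (hk : k ∈ K) (hij : i ≠ j) (hik : i ≠ k) (hjk : j ≠ k) :
    (A.badL μ Q L (i, j, k)).card ≤ ⌈1 / μ⌉₊ := by
  set B := A.badL μ Q L (i, j, k) with hB
  let E : ℕ → Finset (ℕ × ℕ × ℕ) := fun l =>
    (A.nbhd i j (Q i l) (Q j l) ×ˢ A.nbhd i k (Q i l) (Q k l) ×ˢ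
      A.nbhd j k (Q j l) (Q k l)).filter fun t => A.Edge t.1 t.2.1 t.2.2
  set N : ℝ := ((A.P i j).card : ℝ) * ((A.P i k).card : ℝ) * ((A.P j k).card : ℝ) with hN
  have hne : ∀ a ∈ K, ∀ l ∈ L, a ≠ l := fun a ha l hl h =>
    Finset.disjoint_left.1 hKL ha (h ▸ hl)
  have hdis : (B : Set ℕ).PairwiseDisjoint E := by
    intro l hl m hm hlm
    have hlL : l ∈ L := (mem_filter.1 hl).1
    have hmL : m ∈ L := (mem_filter.1 hm).1
    rw [Function.onFun, Finset.disjoint_left]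
    rintro ⟨x, y, z⟩ h1 h2
    simp only [E, nbhd, mem_filter, mem_product] at h1 h2
    obtain ⟨⟨⟨hx, e1⟩, ⟨hy, e2⟩, hz, e3⟩, e⟩ := h1
    obtain ⟨⟨⟨-, e1'⟩, ⟨-, e2'⟩, -, e3'⟩, -⟩ := h2
    obtain ⟨v, hvP, hve⟩ := hv (l, m) (mem_offDiag.2 ⟨hlL, hmL, hlm⟩)
    exact hA (k5_explicit A i j k l m x y z v Q (hK hi) (hK hj) (hK hk) (hL hlL) (hL hmL)
      hij hik hjk hlm (hne _ hi _ hlL) (hne _ hj _ hlL) (hne _ hk _ hlL)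
      (hne _ hi _ hmL) (hne _ hj _ hmL) (hne _ hk _ hmL) hx hy hz hvP
      (hQ _ hi _ hlL) (hQ _ hj _ hlL) (hQ _ hk _ hlL)
      (hQ _ hi _ hmL) (hQ _ hj _ hmL) (hQ _ hk _ hmL) e e1 e2 e3 e1' e2' e3'
      (hve i hi) (hve j hj) (hve k hk))
  have hsub : B.biUnion E ⊆ A.P i j ×ˢ A.P i k ×ˢ A.P j k := by
    rintro ⟨x, y, z⟩ h
    obtain ⟨l, -, h⟩ := mem_biUnion.1 h
    simp only [E, nbhd, mem_filter, mem_product] at h ⊢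
    exact ⟨h.1.1.1, h.1.2.1.1, h.1.2.2.1⟩
  have h1 : (∑ l ∈ B, ((E l).card : ℝ)) ≤ N := by
    have := card_le_card hsub
    rw [card_biUnion hdis, card_product, card_product, ← mul_assoc] at this
    rw [hN]
    exact_mod_cast this
  have h2 : (B.card : ℝ) * (μ * N) ≤ ∑ l ∈ B, ((E l).card : ℝ) := by
    rw [← nsmul_eq_mul]
    apply Finset.card_nsmul_le_sum
    intro l hl
    exact (mem_filter.1 hl).2.le
  have hNpos : 0 < N := by
    have a1 := (A.Pnonempty i j (hK hi) (hK hj) hij).card_pos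
    have a2 := (A.Pnonempty i k (hK hi) (hK hk) hik).card_pos
    have a3 := (A.Pnonempty j k (hK hj) (hK hk) hjk).card_pos
    positivity
  have h3 : (B.card : ℝ) * μ ≤ 1 := by
    by_contra h
    push Not at h
    nlinarith
  have h4 : (B.card : ℝ) ≤ 1 / μ := by rw [le_div_iff₀ hμ]; exact h3
  exact_mod_cast h4.trans (Nat.le_ceil _)

end ReducedHG

theorem links_are_holes :
    ∀ (t : ℕ) (μ d : ℝ), 0 < μ → 0 < d → ∃ s : ℕ,
      ∀ A : ReducedHG, A.EEDense d → ¬ A.SupportsK5 →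
        ∀ K L : Finset ℕ, K ⊆ A.I → L ⊆ A.I → Disjoint K L →
          s ≤ K.card → s ≤ L.card →
          ∀ Q : ℕ → ℕ → ℕ, A.IsTransversal2 K L Q →
            ∃ Ks Ls : Finset ℕ, Ks ⊆ K ∧ Ls ⊆ L ∧ Ks.card = t ∧ Ls.card = t ∧
              ∀ l ∈ Ls, A.IsHoleW μ d Ks (A.link Ks (fun k => Q k l)) := by
  intro t μ d hμ hd
  set n : ℕ := t * (t * t) * ⌈1 / μ⌉₊ + t with hn
  refine ⟨max n ⌈(t : ℝ) / d ^ (n * n - n)⌉₊, ?_⟩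
  intro A hA hK5 K L hK hL hKL hsK hsL Q hQ
  obtain ⟨L0, hL0, hL0c⟩ := Finset.exists_subset_card_eq ((le_max_left _ _).trans hsL)
  have hQ0 : A.IsTransversal2 K L0 Q := fun k hk l hl => hQ k hk l (hL0 hl)
  have hKL0 : Disjoint K L0 := hKL.mono_right hL0
  obtain ⟨K', hK', hc, hv⟩ := A.shrink hd hA K L0 hK (hL0.trans hL) hKL0 Q hQ0 L0.offDiag
    Subset.rfl
  have htK : t ≤ K'.card := by
    rw [offDiag_card, hL0c] at hc
    have h1 : (t : ℝ) / d ^ (n * n - n) ≤ K.card :=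
      (Nat.le_ceil _).trans (by exact_mod_cast (le_max_right _ _).trans hsK)
    rw [div_le_iff₀ (by positivity)] at h1
    have : (t : ℝ) ≤ K'.card := by linarith
    exact_mod_cast this
  obtain ⟨Ks, hKs, hKsc⟩ := Finset.exists_subset_card_eq htK
  have hKsK : Ks ⊆ K := hKs.trans hK'
  let T := (Ks ×ˢ Ks ×ˢ Ks).filter fun p => p.1 ≠ p.2.1 ∧ p.1 ≠ p.2.2 ∧ p.2.1 ≠ p.2.2
  let Bad := T.biUnion fun p => A.badL μ Q L0 p
  have hBad : Bad.card ≤ t * (t * t) * ⌈1 / μ⌉₊ := by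
    have hT : T.card ≤ t * (t * t) := by
      refine (card_filter_le _ _).trans ?_
      rw [card_product, card_product, hKsc]
    refine (Finset.card_biUnion_le_card_mul _ _ ⌈1 / μ⌉₊ ?_).trans (Nat.mul_le_mul_right _ hT)
    rintro ⟨i, j, k⟩ hp
    simp only [T, mem_filter, mem_product] at hp
    obtain ⟨⟨hi, hj, hk⟩, hij, hik, hjk⟩ := hp
    exact A.badL_card hK5 hμ Ks L0 (hKsK.trans hK) (hL0.trans hL) (hKL0.mono_left hKsK) Q
      (fun k hk l hl => hQ0 k (hKsK hk) l hl)
      (fun p hp => by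
        obtain ⟨v, h1, h2⟩ := hv p hp
        exact ⟨v, h1, fun k hk => h2 k (hKs hk)⟩) i j k hi hj hk hij hik hjk
  have hgood : t ≤ (L0 \ Bad).card := by
    have := Finset.le_card_sdiff Bad L0
    omega
  obtain ⟨Ls, hLs, hLsc⟩ := Finset.exists_subset_card_eq hgood
  refine ⟨Ks, Ls, hKsK, fun l hl => hL0 (mem_sdiff.1 (hLs hl)).1, hKsc, hLsc, ?_⟩
  intro l hl
  obtain ⟨hlL0, hlB⟩ := mem_sdiff.1 (hLs hl)
  have hne : ∀ a ∈ Ks, l ≠ a := fun a ha h =>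
    Finset.disjoint_left.1 hKL0 (hKsK ha) (h ▸ hlL0)
  have hw : ∀ i ∈ Ks, ∀ j ∈ Ks, i ≠ j → d * ((A.P i j).card : ℝ) ≤
      ((A.link Ks (fun k => Q k l) ∩ A.P i j).card : ℝ) := by
    intro i hi j hj hij
    rw [A.link_inter Ks _ i j hi hj hij]
    exact hA l i j (hL (hL0 hlL0)) (hK (hKsK hi)) (hK (hKsK hj)) (hne i hi) (hne j hj) hij _
      (A.Psymm i l ▸ hQ0 i (hKsK hi) l hlL0) _ (A.Psymm j l ▸ hQ0 j (hKsK hj) l hlL0)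
  refine ⟨⟨?_, ?_⟩, hw⟩
  · intro i hi j hj hij
    have h1 := hw i hi j hj hij
    have h2 := (A.Pnonempty i j (hK (hKsK hi)) (hK (hKsK hj)) hij).card_pos
    have h3 : (0 : ℝ) < ((A.link Ks (fun k => Q k l) ∩ A.P i j).card : ℝ) :=
      lt_of_lt_of_le (by positivity) h1
    exact card_pos.1 (by exact_mod_cast h3)
  · intro i hi j hj k hk hij hik hjk
    rw [A.link_inter Ks _ i j hi hj hij, A.link_inter Ks _ i k hi hk hik,
      A.link_inter Ks _ j k hj hk hjk]
    by_contra h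
    push Not at h
    apply hlB
    refine mem_biUnion.2 ⟨(i, j, k), ?_, mem_filter.2 ⟨hlL0, h⟩⟩
    simp only [T, mem_filter, mem_product]
    exact ⟨⟨hi, hj, hk⟩, hij, hik, hjk⟩
end
end

section
/- Let δ > 0. There exists s ∈ ℕ such that the following holds: if 𝒜 is a reduced hypergraph with index set I, K, L, M ⊆ I are pairwise disjoint subsets each of size at least s, and 𝒬 (a (K,L)-transversal), ℛ (a (K,M)-transversal), 𝒮 (an (L,M)-transversal) form an inhabited triple such that both pairs 𝒬ℛ and 𝒬𝒮 have δ-intersecting links, then 𝒜 supports a K₅⁽³⁾. -/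
open Finset Classical

noncomputable section

lemma pig_aux {α : Type*} (U : Finset α) (hU : U.Nonempty) (L : Finset ℕ) (B : ℕ → Finset α)
    (hB : ∀ l ∈ L, B l ⊆ U) (δ : ℝ) (hδ : ∀ l ∈ L, δ * (U.card : ℝ) ≤ ((B l).card : ℝ))
    (hL : 1 < δ * (L.card : ℝ)) :
    ∃ l ∈ L, ∃ l' ∈ L, l ≠ l' ∧ ∃ x, x ∈ B l ∧ x ∈ B l' := by
  by_contra! h
  have hd : (L : Set ℕ).PairwiseDisjoint B := by
    intro a ha b hb hab
    exact Finset.disjoint_left.2 (h a ha b hb hab)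
  have h1 : (L.biUnion B).card = ∑ l ∈ L, (B l).card := Finset.card_biUnion hd
  have h2 : (L.biUnion B).card ≤ U.card := Finset.card_le_card (Finset.biUnion_subset.2 hB)
  have h3 : ∑ _l ∈ L, δ * (U.card : ℝ) ≤ ∑ l ∈ L, ((B l).card : ℝ) := Finset.sum_le_sum hδ
  rw [Finset.sum_const, nsmul_eq_mul] at h3
  have h4 : ∑ l ∈ L, ((B l).card : ℝ) ≤ (U.card : ℝ) := by
    rw [h1] at h2
    exact_mod_cast h2
  have h5 : (0 : ℝ) < U.card := by exact_mod_cast hU.card_pos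
  nlinarith

lemma inj_aux {a b c d e : ℕ} (h1 : a ≠ b) (h2 : a ≠ c) (h3 : a ≠ d) (h4 : a ≠ e) (h5 : b ≠ c)
    (h6 : b ≠ d) (h7 : b ≠ e) (h8 : c ≠ d) (h9 : c ≠ e) (h10 : d ≠ e) :
    Function.Injective ![a, b, c, d, e] := by
  have h : [a, b, c, d, e].Nodup := by simp [*]
  exact List.nodup_ofFn.1 (by simpa using h)

lemma k5_aux (A : ReducedHG) (v : Fin 5 → ℕ) (hv : Function.Injective v)
    (hI : ∀ i, v i ∈ A.I) (g : Fin 5 → Fin 5 → ℕ)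
    (hg : ∀ i j, i < j → g i j ∈ A.P (v i) (v j))
    (he : ∀ i j k, i < j → j < k → A.Edge (g i j) (g i k) (g j k)) : A.SupportsK5 := by
  set h : Fin 5 → Fin 5 → ℕ := fun i j => g (min i j) (max i j) with hh
  have hs : ∀ i j, h i j = h j i := fun i j => by simp only [hh, min_comm, max_comm]
  have hlt : ∀ i j, i < j → h i j = g i j := fun i j hij => by
    simp only [hh, min_eq_left hij.le, max_eq_right hij.le]
  have hP : ∀ i j, i ≠ j → h i j ∈ A.P (v i) (v j) := by
    intro i j hij
    rcases lt_or_gt_of_ne hij with h1 | h1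
    · rw [hlt i j h1]; exact hg i j h1
    · rw [hs, A.Psymm, hlt j i h1]; exact hg j i h1
  have he' : ∀ i j k, i < j → j < k → A.Edge (h i j) (h i k) (h j k) := by
    intro i j k h1 h2
    rw [hlt i j h1, hlt j k h2, hlt i k (h1.trans h2)]
    exact he i j k h1 h2
  have hE : ∀ i j k, i ≠ j → i ≠ k → j ≠ k → A.Edge (h i j) (h i k) (h j k) := by
    intro i j k h1 h2 h3
    have S1 := A.EdgeSymm
    have S2 := A.EdgeSymm'
    rcases lt_or_gt_of_ne h1 with a | a <;> rcases lt_or_gt_of_ne h2 with b | b <;>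
      rcases lt_or_gt_of_ne h3 with c | c
    · exact he' _ _ _ a c
    · have := he' _ _ _ b c
      rw [hs k j] at this
      exact S1 _ _ _ this
    · exact absurd (a.trans c) (not_lt.2 b.le)
    · have := he' _ _ _ b a
      rw [hs k j, hs k i] at this
      exact S1 _ _ _ (S2 _ _ _ this)
    · have := he' _ _ _ a b
      rw [hs j i] at this
      exact S2 _ _ _ this
    · exact absurd (b.trans c) (not_lt.2 a.le)
    · have := he' _ _ _ c b
      rw [hs j i, hs k i] at this
      exact S2 _ _ _ (S1 _ _ _ this)
    · have := he' _ _ _ c a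
      rw [hs k j, hs k i, hs j i] at this
      exact S1 _ _ _ (S2 _ _ _ (S1 _ _ _ this))
  have hinv : ∀ i, Function.invFun v (v i) = i := Function.leftInverse_invFun hv
  refine ⟨Finset.univ.image v, ?_, ?_, fun a b => h (Function.invFun v a) (Function.invFun v b),
    ?_, ?_, ?_⟩
  · intro x hx
    obtain ⟨i, -, rfl⟩ := Finset.mem_image.1 hx
    exact hI i
  · rw [Finset.card_image_of_injective _ hv]; simp
  · intro i _ j _
    exact hs _ _
  · intro a ha b hb hab
    obtain ⟨i, -, rfl⟩ := Finset.mem_image.1 ha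
    obtain ⟨j, -, rfl⟩ := Finset.mem_image.1 hb
    simp only [hinv]
    exact hP i j (fun e => hab (by rw [e]))
  · intro a ha b hb c hc hab hac hbc
    obtain ⟨i, -, rfl⟩ := Finset.mem_image.1 ha
    obtain ⟨j, -, rfl⟩ := Finset.mem_image.1 hb
    obtain ⟨k, -, rfl⟩ := Finset.mem_image.1 hc
    simp only [hinv]
    exact hE i j k (fun e => hab (by rw [e])) (fun e => hac (by rw [e])) (fun e => hbc (by rw [e]))

/-- Lemma (`lem:greekleters`): if an inhabited triple of transversals on sufficiently large
disjoint index sets is such that both pairs `𝒬ℛ` and `𝒬𝒮` have `δ`-intersecting links,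
then the reduced hypergraph supports a `K₅⁽³⁾`. -/
theorem two_intersecting_pairs_give_K5 :
    ∀ δ : ℝ, 0 < δ → ∃ s : ℕ,
      ∀ (A : ReducedHG) (K L M : Finset ℕ),
        K ⊆ A.I → L ⊆ A.I → M ⊆ A.I →
        Disjoint K L → Disjoint K M → Disjoint L M →
        s ≤ K.card → s ≤ L.card → s ≤ M.card →
        ∀ Q R S : ℕ → ℕ → ℕ,
          A.IsTransversal2 K L Q → A.IsTransversal2 K M R → A.IsTransversal2 L M S →
          A.InhabitedTriple2 K L M Q R S →
          A.IntersectingLinks δ K L M Q R →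
          A.IntersectingLinks δ L K M (fun l k => Q k l) S →
          A.SupportsK5 := by
  intro δ hδ
  obtain ⟨t, ht⟩ := exists_nat_gt (1 / δ)
  have ht' : 1 < δ * (t : ℝ) := by rwa [div_lt_iff₀ hδ, mul_comm] at ht
  have hD : 0 < δ ^ (t * t - t) := pow_pos hδ _
  obtain ⟨s0, hs0⟩ := exists_nat_gt (1 / δ ^ (t * t - t))
  rw [div_lt_iff₀ hD, mul_comm] at hs0
  have ht0 : 1 ≤ t := by
    rcases Nat.eq_zero_or_pos t with h | h
    · subst h; norm_num at ht'
    · exact h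
  refine ⟨s0 + t, ?_⟩
  intro A K L M hK hL hM dKL dKM dLM cK cL cM Q R S hQ hR hS hin hQR hQS
  obtain ⟨K0, hK0, cK0⟩ := Finset.exists_subset_card_eq (show t ≤ K.card by omega)
  obtain ⟨m, hm⟩ : M.Nonempty := Finset.card_pos.1 (by omega)
  have hKs : ∀ x : K0.offDiag, x.1.1 ∈ K ∧ x.1.2 ∈ K ∧ x.1.1 ≠ x.1.2 := by
    intro x
    have := Finset.mem_offDiag.1 x.2
    exact ⟨hK0 this.1, hK0 this.2.1, this.2.2⟩
  have hne : ∀ {X Y : Finset ℕ}, Disjoint X Y → ∀ {x y}, x ∈ X → y ∈ Y → x ≠ y := by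
    intro X Y d x y hx hy e
    subst e
    exact Finset.disjoint_left.1 d hx hy
  obtain ⟨l, hl, l', hl', hll, F, hF⟩ := pig_aux
    (Fintype.piFinset fun x : K0.offDiag => A.P x.1.1 x.1.2)
    (by
      rw [Fintype.piFinset_nonempty]
      intro x
      exact A.Pnonempty _ _ (hK (hKs x).1) (hK (hKs x).2.1) (hKs x).2.2)
    L
    (fun l => Fintype.piFinset fun x : K0.offDiag =>
      A.nbhd x.1.1 x.1.2 (Q x.1.1 l) (Q x.1.2 l) ∩ A.nbhd x.1.1 x.1.2 (R x.1.1 m) (R x.1.2 m))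
    (by
      intro l _
      apply Fintype.piFinset_subset
      intro x
      exact Finset.inter_subset_left.trans (Finset.filter_subset _ _))
    (δ ^ (t * t - t))
    (by
      intro l hl
      rw [Fintype.card_piFinset, Fintype.card_piFinset]
      push_cast
      have : δ ^ (t * t - t) = ∏ _x : K0.offDiag, δ := by
        rw [Finset.prod_const, Finset.card_univ, Fintype.card_coe, Finset.offDiag_card, cK0]
      rw [this, ← Finset.prod_mul_distrib]
      apply Finset.prod_le_prod
      · intro x _; positivity
      · intro x _
        exact hQR _ (hKs x).1 _ (hKs x).2.1 (hKs x).2.2 l hl m hm)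
    (by
      refine hs0.trans_le (mul_le_mul_of_nonneg_left ?_ hD.le)
      exact_mod_cast (by omega : s0 ≤ L.card))
  obtain ⟨k, hk, k', hk', hkk, q, hq⟩ := pig_aux (A.P l l') (A.Pnonempty _ _ (hL hl) (hL hl') hll)
    K0 (fun k => A.nbhd l l' (Q k l) (Q k l') ∩ A.nbhd l l' (S l m) (S l' m))
    (fun k _ => Finset.inter_subset_left.trans (Finset.filter_subset _ _)) δ
    (fun k hk => hQS l hl l' hl' hll k (hK0 hk) m hm) (by rw [cK0]; exact ht')
  rw [Fintype.mem_piFinset, Fintype.mem_piFinset] at hF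
  have hx : (k, k') ∈ K0.offDiag := Finset.mem_offDiag.2 ⟨hk, hk', hkk⟩
  have h1 := hF.1 ⟨(k, k'), hx⟩
  have h2 := hF.2 ⟨(k, k'), hx⟩
  generalize F ⟨(k, k'), hx⟩ = p at h1 h2
  simp only [ReducedHG.nbhd, Finset.mem_inter, Finset.mem_filter] at h1 h2 hq
  have hk := hK0 hk
  have hk' := hK0 hk'
  have rot : ∀ a b c, A.Edge a b c → A.Edge c a b := fun a b c h =>
    A.EdgeSymm _ _ _ (A.EdgeSymm' _ _ _ h)
  have e1 := rot _ _ _ h1.1.2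
  have e2 := rot _ _ _ h2.1.2
  have e3 := rot _ _ _ h1.2.2
  have e4 := hq.1.1.2
  have e5 := hq.2.1.2
  have e6 := rot _ _ _ hq.1.2.2
  have n1 := hne dKL hk hl
  have n2 := hne dKL hk hl'
  have n3 := hne dKL hk' hl
  have n4 := hne dKL hk' hl'
  have n5 := hne dKM hk hm
  have n6 := hne dKM hk' hm
  have n7 := hne dLM hl hm
  have n8 := hne dLM hl' hm
  refine k5_aux A ![k, k', l, l', m] ?_ ?_
    ![![0, p, Q k l, Q k l', R k m], ![0, 0, Q k' l, Q k' l', R k' m], ![0, 0, 0, q, S l m],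
      ![0, 0, 0, 0, S l' m], ![0, 0, 0, 0, 0]] ?_ ?_
  · exact inj_aux hkk n1 n2 n5 n3 n4 n6 hll n7 n8
  · intro i
    fin_cases i
    exacts [hK hk, hK hk', hL hl, hL hl', hM hm]
  · intro i j hij
    fin_cases i <;> fin_cases j <;> first
      | exact absurd hij (by decide)
      | exact h1.1.1
      | exact hq.1.1.1
      | exact hQ _ hk _ hl
      | exact hQ _ hk _ hl'
      | exact hQ _ hk' _ hl
      | exact hQ _ hk' _ hl'
      | exact hR _ hk _ hm
      | exact hR _ hk' _ hm
      | exact hS _ hl _ hm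
      | exact hS _ hl' _ hm
  · intro i j r hij hjr
    fin_cases i <;> fin_cases j <;> first
      | exact absurd hij (by decide)
      | (fin_cases r <;> first
          | exact absurd hjr (by decide)
          | exact e1
          | exact e2
          | exact e3
          | exact e4
          | exact e5
          | exact e6
          | exact hin _ hk _ hl _ hm
          | exact hin _ hk _ hl' _ hm
          | exact hin _ hk' _ hl _ hm
          | exact hin _ hk' _ hl' _ hm)
end
end
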